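/- arXiv:1108.5346 — 2 statements merged into one kernel-verified Lean document; each statement's English description precedes it below -/
import Mathlib

section
/- Let 1 ≤ p < d/2. There exists a constant κ ∈ (0, ∞), depending only on p, d and the norm, such that for every probability measure μ on [0,1)^d and every N ≥ 1, E[ρ_p^p(μ, μ̂_N)]^{1/p} ≤ κ · N^{−1/d}, where μ̂_N = (1/N) ∑_{j=1}^N δ_{X_j} is the empirical measure of N i.i.d. μ-distributed random variables X_1, …, X_N. One may take κ = 𝔡 · 2^{(d−2)/(2p)} · (1/(1 − 2^{p − d/2}) + 1/(1 − 2^{−p}))^{1/p}, where 𝔡 is the diameter of [0,1)^d. -/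
open MeasureTheory ENNReal

/-- The set of couplings (transports) between two measures on `ℝ^d`. -/
def couplings {d : ℕ} (μ ν : Measure (Fin d → ℝ)) :
    Set (Measure ((Fin d → ℝ) × (Fin d → ℝ))) :=
  {ξ | ξ.map Prod.fst = μ ∧ ξ.map Prod.snd = ν}

/-- `ρ_p^p(μ,ν)`: the `p`-th power of the `p`-th Wasserstein metric. -/
noncomputable def WpPow {d : ℕ} (p : ℝ) (μ ν : Measure (Fin d → ℝ)) : ℝ≥0∞ :=
  ⨅ ξ ∈ couplings μ ν, ∫⁻ z, (‖z.1 - z.2‖₊ : ℝ≥0∞) ^ p ∂ξ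

/-- The empirical measure `(1/N) ∑_{j<N} δ_{x_j}` of a vector of `N` points. -/
noncomputable def empMeas {d : ℕ} (N : ℕ) (x : Fin N → (Fin d → ℝ)) :
    Measure (Fin d → ℝ) :=
  (N : ℝ≥0∞)⁻¹ • ∑ j, Measure.dirac (x j)

/-- `E[ρ_p^p(μ, μ̂_N)]`: the expected `p`-th power Wasserstein distance between `μ`
and the empirical measure of `N` i.i.d. `μ`-distributed samples (modelled on the
canonical product space). -/
noncomputable def expWpPow {d : ℕ} (p : ℝ) (μ : Measure (Fin d → ℝ)) (N : ℕ) :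
    ℝ≥0∞ :=
  ∫⁻ x, WpPow p μ (empMeas N x) ∂(Measure.pi fun _ : Fin N => μ)

/-- The unit cube `[0,1)^d`. -/
def unitBox (d : ℕ) : Set (Fin d → ℝ) := Set.univ.pi fun _ => Set.Ico (0 : ℝ) 1

section Coupling

variable {X I : Type*} [MeasurableSpace X] [MeasurableSpace I]

theorem exists_partial_coupling_of_le (a b : Measure X) [IsFiniteMeasure a] [IsFiniteMeasure b]
    (hab : b Set.univ ≤ a Set.univ) :
    ∃ (η : Measure (X × X)) (a' : Measure X),
      η.map Prod.fst + a' = a ∧ η.map Prod.snd = b ∧ η ≪ a.prod b := by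
  by_cases ha : a Set.univ = 0
  · have hb : b = 0 := Measure.measure_univ_eq_zero.1 (le_antisymm (hab.trans ha.le) bot_le)
    refine ⟨0, a, by simp, by simp [hb], ?_⟩
    exact Measure.AbsolutelyContinuous.zero _
  · have hr : b Set.univ * (a Set.univ)⁻¹ ≤ 1 := by
      rw [← div_eq_mul_inv]
      exact ENNReal.div_le_of_le_mul (by simpa using hab)
    refine ⟨(a Set.univ)⁻¹ • a.prod b, (1 - b Set.univ * (a Set.univ)⁻¹) • a, ?_, ?_, ?_⟩
    · rw [Measure.map_smul, Measure.map_fst_prod, smul_smul, mul_comm, ← add_smul,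
        add_tsub_cancel_of_le hr, one_smul]
    · rw [Measure.map_smul, Measure.map_snd_prod, smul_smul,
        ENNReal.inv_mul_cancel ha (measure_ne_top _ _), one_smul]
    · exact Measure.smul_absolutelyContinuous

/-- Two finite measures can be coupled up to the excess mass of one of them. -/
theorem exists_partial_coupling (a b : Measure X) [IsFiniteMeasure a] [IsFiniteMeasure b] :
    ∃ (η : Measure (X × X)) (a' b' : Measure X),
      η.map Prod.fst + a' = a ∧ η.map Prod.snd + b' = b ∧ (a' = 0 ∨ b' = 0) ∧
        η ≪ a.prod b := by
  rcases le_total (b Set.univ) (a Set.univ) with h | h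
  · obtain ⟨η, a', h1, h2, h3⟩ := exists_partial_coupling_of_le a b h
    exact ⟨η, a', 0, h1, by simpa using h2, Or.inr rfl, h3⟩
  · obtain ⟨η, b', h1, h2, h3⟩ := exists_partial_coupling_of_le b a h
    refine ⟨η.map Prod.swap, 0, b', ?_, ?_, Or.inl rfl, ?_⟩
    · rw [Measure.map_map measurable_fst measurable_swap, add_zero]
      exact h2
    · rw [Measure.map_map measurable_snd measurable_swap]
      exact h1
    · rw [← Measure.prod_swap]
      exact h3.map measurable_swap

theorem sum_restrict_fiber [Countable I] [MeasurableSingletonClass I] {c : X → I}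
    (hc : Measurable c) (a : Measure X) :
    Measure.sum (fun i => a.restrict (c ⁻¹' {i})) = a := by
  rw [← Measure.restrict_iUnion (fun i j hij => Disjoint.preimage c (by simpa using hij))
    (fun i => hc (measurableSet_singleton i)),
    Set.iUnion_eq_univ_iff.2 fun x => ⟨c x, rfl⟩, Measure.restrict_univ]

/-- Partial couplings carried out separately on each fibre of `c`. -/
theorem exists_partial_coupling_fiber [Countable I] [MeasurableSingletonClass I] {c : X → I}
    (hc : Measurable c) (a b : Measure X) [IsFiniteMeasure a] [IsFiniteMeasure b] :
    ∃ (η : Measure (X × X)) (a' b' : Measure X),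
      η.map Prod.fst + a' = a ∧ η.map Prod.snd + b' = b ∧
        η {z | c z.1 ≠ c z.2} = 0 ∧ ∀ i, a' (c ⁻¹' {i}) = 0 ∨ b' (c ⁻¹' {i}) = 0 := by
  have hm : ∀ i, MeasurableSet (c ⁻¹' {i}) := fun i => hc (measurableSet_singleton i)
  choose η a' b' h1 h2 h3 h4 using fun i =>
    exists_partial_coupling (a.restrict (c ⁻¹' {i})) (b.restrict (c ⁻¹' {i}))
  have ha' : ∀ i j, i ≠ j → a' j (c ⁻¹' {i}) = 0 := by
    intro i j hij
    have : a' j ≤ a.restrict (c ⁻¹' {j}) := by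
      rw [← h1 j]; exact Measure.le_add_left le_rfl
    refine le_antisymm ((this _).trans ?_) bot_le
    rw [Measure.restrict_apply (hm i), ← Set.preimage_inter,
      Set.singleton_inter_eq_empty.2 (by simpa using hij)]
    simp
  have hb' : ∀ i j, i ≠ j → b' j (c ⁻¹' {i}) = 0 := by
    intro i j hij
    have : b' j ≤ b.restrict (c ⁻¹' {j}) := by
      rw [← h2 j]; exact Measure.le_add_left le_rfl
    refine le_antisymm ((this _).trans ?_) bot_le
    rw [Measure.restrict_apply (hm i), ← Set.preimage_inter,
      Set.singleton_inter_eq_empty.2 (by simpa using hij)]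
    simp
  have hS : MeasurableSet {z : X × X | c z.1 ≠ c z.2} := by
    have : {z : X × X | c z.1 ≠ c z.2} = ⋃ i, (c ⁻¹' {i}) ×ˢ (c ⁻¹' {i})ᶜ := by
      ext z; simp [eq_comm]
    rw [this]
    exact MeasurableSet.iUnion fun i => (hm i).prod (hm i).compl
  refine ⟨Measure.sum η, Measure.sum a', Measure.sum b', ?_, ?_, ?_, ?_⟩
  · rw [Measure.map_sum measurable_fst.aemeasurable, Measure.sum_add_sum]
    simp_rw [h1]
    exact sum_restrict_fiber hc a
  · rw [Measure.map_sum measurable_snd.aemeasurable, Measure.sum_add_sum]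
    simp_rw [h2]
    exact sum_restrict_fiber hc b
  · rw [Measure.sum_apply _ hS, ENNReal.tsum_eq_zero]
    intro i
    refine h4 i ?_
    rw [Measure.prod_restrict, Measure.restrict_apply hS]
    convert measure_empty (μ := a.prod b)
    ext z
    simp only [Set.mem_inter_iff, Set.mem_ofPred_eq, Set.mem_prod, Set.mem_preimage,
      Set.mem_singleton_iff, Set.mem_empty_iff_false, iff_false]
    grind
  · intro i
    rw [Measure.sum_apply _ (hm i), Measure.sum_apply _ (hm i), ENNReal.tsum_eq_zero,
      ENNReal.tsum_eq_zero]
    rcases h3 i with h | h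
    · left
      intro j
      by_cases hij : i = j
      · subst hij; simp [h]
      · exact ha' i j hij
    · right
      intro j
      by_cases hij : i = j
      · subst hij; simp [h]
      · exact hb' i j hij

theorem measure_fst_eq_measure_snd_of_fiber {ξ : Measure (X × X)} {c : X → I}
    [MeasurableSingletonClass I] (hc : Measurable c)
    (h : ξ {z | c z.1 ≠ c z.2} = 0) (i : I) :
    ξ.map Prod.fst (c ⁻¹' {i}) = ξ.map Prod.snd (c ⁻¹' {i}) := by
  have hm : MeasurableSet (c ⁻¹' {i}) := hc (measurableSet_singleton i)
  rw [Measure.map_apply measurable_fst hm, Measure.map_apply measurable_snd hm]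
  refine measure_congr ?_
  have : ∀ᵐ z ∂ξ, c z.1 = c z.2 := h
  filter_upwards [this] with z hz
  refine propext ?_
  change c z.1 = i ↔ c z.2 = i
  rw [hz]

/-- A partial coupling of `μ` and `ν` which, for each of the nested partitions into fibres of
`c 0, …, c k`, separates at most the mass that any coupling has to separate. -/
theorem exists_nested_partial_coupling [Countable I] [MeasurableSingletonClass I]
    (μ ν : Measure X) [IsFiniteMeasure μ] [IsFiniteMeasure ν] (k : ℕ) :
    ∀ c : ℕ → X → I, (∀ n, Measurable (c n)) →
      (∀ n x y, c (n + 1) x = c (n + 1) y → c n x = c n y) →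
    ∃ (ξ : Measure (X × X)) (α β : Measure X),
      ξ.map Prod.fst + α = μ ∧ ξ.map Prod.snd + β = ν ∧
        ξ {z | c 0 z.1 ≠ c 0 z.2} = 0 ∧
        (∀ i, α (c 0 ⁻¹' {i}) = 0 ∨ β (c 0 ⁻¹' {i}) = 0) ∧
        ∀ m ≤ k, ξ {z | c m z.1 ≠ c m z.2} + α Set.univ ≤
          ∑' i, (μ (c m ⁻¹' {i}) - ν (c m ⁻¹' {i})) := by
  have base : ∀ (c : X → I), Measurable c → ∀ (ξ : Measure (X × X)) (α β : Measure X),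
      ξ.map Prod.fst + α = μ → ξ.map Prod.snd + β = ν → ξ {z | c z.1 ≠ c z.2} = 0 →
      (∀ i, α (c ⁻¹' {i}) = 0 ∨ β (c ⁻¹' {i}) = 0) →
      ξ {z | c z.1 ≠ c z.2} + α Set.univ ≤ ∑' i, (μ (c ⁻¹' {i}) - ν (c ⁻¹' {i})) := by
    intro c hc ξ α β h1 h2 h3 h4
    rw [h3, zero_add]
    nth_rewrite 1 [← sum_restrict_fiber hc α]
    rw [Measure.sum_apply _ MeasurableSet.univ]
    refine ENNReal.tsum_le_tsum fun i => ?_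
    rw [Measure.restrict_apply MeasurableSet.univ, Set.univ_inter]
    rcases h4 i with h | h
    · simp [h]
    · have e := measure_fst_eq_measure_snd_of_fiber hc h3 i
      have e1 : μ (c ⁻¹' {i}) = ξ.map Prod.fst (c ⁻¹' {i}) + α (c ⁻¹' {i}) := by
        rw [← h1, Measure.add_apply]
      have e2 : ν (c ⁻¹' {i}) = ξ.map Prod.snd (c ⁻¹' {i}) := by
        rw [← h2, Measure.add_apply, h, add_zero]
      have hf : ν (c ⁻¹' {i}) ≠ ⊤ := measure_ne_top _ _
      rw [e1, e, ← e2, ENNReal.add_sub_cancel_left hf]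
  induction k with
  | zero =>
    intro c hc _
    obtain ⟨η, a, b, h1, h2, h3, h4⟩ := exists_partial_coupling_fiber (hc 0) μ ν
    refine ⟨η, a, b, h1, h2, h3, h4, fun m hm => ?_⟩
    obtain rfl := Nat.le_zero.1 hm
    exact base (c 0) (hc 0) η a b h1 h2 h3 h4
  | succ k ih =>
    intro c hc hn
    obtain ⟨ξ, α, β, h1, h2, h3, -, h5⟩ :=
      ih (fun n => c (n + 1)) (fun n => hc (n + 1)) (fun n => hn (n + 1))
    have : IsFiniteMeasure α := isFiniteMeasure_of_le μ (h1 ▸ Measure.le_add_left le_rfl)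
    have : IsFiniteMeasure β := isFiniteMeasure_of_le ν (h2 ▸ Measure.le_add_left le_rfl)
    obtain ⟨η, α', β', g1, g2, g3, g4⟩ := exists_partial_coupling_fiber (hc 0) α β
    have e1 : (ξ + η).map Prod.fst + α' = μ := by
      rw [Measure.map_add _ _ measurable_fst, add_assoc, g1, h1]
    have e2 : (ξ + η).map Prod.snd + β' = ν := by
      rw [Measure.map_add _ _ measurable_snd, add_assoc, g2, h2]
    have e3 : (ξ + η) {z | c 0 z.1 ≠ c 0 z.2} = 0 := by
      rw [Measure.add_apply, g3, add_zero]
      exact measure_mono_null (fun z hz h => hz (hn 0 _ _ h)) h3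
    refine ⟨ξ + η, α', β', e1, e2, e3, g4, fun m hm => ?_⟩
    cases m with
    | zero => exact base (c 0) (hc 0) _ _ _ e1 e2 e3 g4
    | succ m =>
      refine le_trans ?_ (h5 m (by omega))
      rw [Measure.add_apply, add_assoc]
      gcongr
      rw [← g1, Measure.add_apply, Measure.map_apply measurable_fst MeasurableSet.univ]
      gcongr
      simp

/-- A coupling of two measures of equal mass, carried by one fibre of `c 0`, which is
simultaneously optimal for the nested partitions into fibres of `c 0, …, c k`. -/
theorem exists_nested_coupling [Countable I] [MeasurableSingletonClass I]
    (μ ν : Measure X) [IsProbabilityMeasure μ] [IsProbabilityMeasure ν]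
    (c : ℕ → X → I) (hc : ∀ n, Measurable (c n))
    (hn : ∀ n x y, c (n + 1) x = c (n + 1) y → c n x = c n y) (o : I)
    (hμ : ∀ᵐ x ∂μ, c 0 x = o) (hν : ∀ᵐ x ∂ν, c 0 x = o) (k : ℕ) :
    ∃ ξ : Measure (X × X), ξ.map Prod.fst = μ ∧ ξ.map Prod.snd = ν ∧
      ∀ m ≤ k, ξ {z | c m z.1 ≠ c m z.2} ≤
          ∑' i, (μ (c m ⁻¹' {i}) - ν (c m ⁻¹' {i})) := by
  obtain ⟨ξ, α, β, h1, h2, h3, h4, h5⟩ := exists_nested_partial_coupling μ ν k c hc hn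
  have e1 : ξ Set.univ + α Set.univ = 1 := by
    rw [← measure_univ (μ := μ), ← h1, Measure.add_apply,
      Measure.map_apply measurable_fst MeasurableSet.univ, Set.preimage_univ]
  have e2 : ξ Set.univ + β Set.univ = 1 := by
    rw [← measure_univ (μ := ν), ← h2, Measure.add_apply,
      Measure.map_apply measurable_snd MeasurableSet.univ, Set.preimage_univ]
  have hξ : ξ Set.univ ≠ ⊤ := fun h => by simp [h] at e1
  have hαβ : α Set.univ = β Set.univ := by
    rw [← e2] at e1
    exact (ENNReal.add_right_inj hξ).1 e1
  have hα : ∀ᵐ x ∂α, c 0 x = o :=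
    (Measure.absolutelyContinuous_of_le (h1 ▸ Measure.le_add_left le_rfl : α ≤ μ)).ae_le hμ
  have hβ : ∀ᵐ x ∂β, c 0 x = o :=
    (Measure.absolutelyContinuous_of_le (h2 ▸ Measure.le_add_left le_rfl : β ≤ ν)).ae_le hν
  have h0 : α Set.univ = 0 := by
    rcases h4 o with h | h
    · rw [← h]; exact (measure_eq_measure_of_null_sdiff (Set.subset_univ _)
        (by rw [← Set.compl_eq_univ_sdiff]; exact hα)).symm
    · rw [hαβ, ← h]; exact (measure_eq_measure_of_null_sdiff (Set.subset_univ _)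
        (by rw [← Set.compl_eq_univ_sdiff]; exact hβ)).symm
  have ha : α = 0 := Measure.measure_univ_eq_zero.1 h0
  have hb : β = 0 := Measure.measure_univ_eq_zero.1 (hαβ ▸ h0)
  refine ⟨ξ, by simpa [ha] using h1, by simpa [hb] using h2, fun m hm => ?_⟩
  exact le_self_add.trans (h5 m hm)

end Coupling

/-- The index of the half-open dyadic cube of side length `2⁻ⁿ` containing `x`. -/
noncomputable def dyadicCell {d : ℕ} (n : ℕ) (x : Fin d → ℝ) : Fin d → ℕ :=
  fun i => ⌊2 ^ n * x i⌋₊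

theorem measurable_dyadicCell {d : ℕ} (n : ℕ) :
    Measurable (dyadicCell n : (Fin d → ℝ) → Fin d → ℕ) :=
  measurable_pi_iff.2 fun i => Nat.measurable_floor.comp ((measurable_pi_apply i).const_mul _)

theorem dyadicCell_eq_of_succ {d : ℕ} (n : ℕ) (x y : Fin d → ℝ)
    (h : dyadicCell (n + 1) x = dyadicCell (n + 1) y) : dyadicCell n x = dyadicCell n y := by
  have key : ∀ z : Fin d → ℝ, ∀ i, dyadicCell n z i = dyadicCell (n + 1) z i / 2 := by
    intro z i
    have := Nat.floor_div_natCast (2 ^ (n + 1) * z i) 2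
    rw [dyadicCell, dyadicCell, ← this]
    congr 1
    push_cast
    ring
  ext i
  rw [key, key, h]

theorem dyadicCell_lt {d : ℕ} (n : ℕ) {x : Fin d → ℝ} (hx : x ∈ unitBox d) (i : Fin d) :
    dyadicCell n x i < 2 ^ n := by
  have h := hx i (Set.mem_univ i)
  rw [dyadicCell, Nat.floor_lt (mul_nonneg (by positivity) h.1)]
  push_cast
  exact mul_lt_of_lt_one_right (by positivity) h.2

theorem norm_sub_le_of_dyadicCell_eq {d : ℕ} (n : ℕ) {x y : Fin d → ℝ} (hx : x ∈ unitBox d)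
    (hy : y ∈ unitBox d) (h : dyadicCell n x = dyadicCell n y) : ‖x - y‖ ≤ (1 / 2) ^ n := by
  rw [pi_norm_le_iff_of_nonneg (by positivity)]
  intro i
  have hxi := (hx i (Set.mem_univ i)).1
  have hyi := (hy i (Set.mem_univ i)).1
  have e : ⌊2 ^ n * x i⌋₊ = ⌊2 ^ n * y i⌋₊ := congrFun h i
  have h2 : (0 : ℝ) < 2 ^ n := by positivity
  have a1 := Nat.floor_le (mul_nonneg h2.le hxi)
  have a2 := Nat.lt_floor_add_one (2 ^ n * x i)
  have b1 := Nat.floor_le (mul_nonneg h2.le hyi)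
  have b2 := Nat.lt_floor_add_one (2 ^ n * y i)
  rw [e] at a1 a2
  have : |2 ^ n * (x i - y i)| ≤ 1 := by
    rw [abs_le]; constructor <;> linarith
  rw [abs_mul, abs_of_pos h2] at this
  rw [Pi.sub_apply, Real.norm_eq_abs, one_div, inv_pow, ← one_div, le_div_iff₀ h2]
  linarith

/-- The transport cost is controlled by the dyadic levels at which the two points separate. -/
theorem nnnorm_sub_rpow_le {d : ℕ} {p : ℝ} (hp : 0 ≤ p) {z : (Fin d → ℝ) × (Fin d → ℝ)}
    (h1 : z.1 ∈ unitBox d) (h2 : z.2 ∈ unitBox d) (M : ℕ) :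
    (‖z.1 - z.2‖₊ : ℝ≥0∞) ^ p ≤ ENNReal.ofReal ((2 ^ (-p)) ^ M) +
      ∑ n ∈ Finset.range M, ENNReal.ofReal ((2 ^ (-p)) ^ n) *
        {z | dyadicCell (n + 1) z.1 ≠ dyadicCell (n + 1) z.2}.indicator 1 z := by
  have key : ∀ n, dyadicCell n z.1 = dyadicCell n z.2 →
      (‖z.1 - z.2‖₊ : ℝ≥0∞) ^ p ≤ ENNReal.ofReal ((2 ^ (-p)) ^ n) := by
    intro n h
    have := norm_sub_le_of_dyadicCell_eq n h1 h2 h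
    have e : (‖z.1 - z.2‖₊ : ℝ≥0∞) = ENNReal.ofReal ‖z.1 - z.2‖ := by
      rw [ofReal_norm]; rfl
    rw [e, ENNReal.ofReal_rpow_of_nonneg (norm_nonneg _) hp]
    refine ENNReal.ofReal_le_ofReal ((Real.rpow_le_rpow (norm_nonneg _) this hp).trans_eq ?_)
    rw [← Real.rpow_natCast, ← Real.rpow_natCast, ← Real.rpow_mul (by norm_num),
      ← Real.rpow_mul (by norm_num), one_div, Real.inv_rpow (by norm_num),
      ← Real.rpow_neg (by norm_num)]
    congr 1
    ring
  induction M with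
  | zero =>
    refine (key 0 ?_).trans le_self_add
    ext i
    have := dyadicCell_lt 0 h1 i
    have := dyadicCell_lt 0 h2 i
    omega
  | succ M ih =>
    by_cases h : dyadicCell (M + 1) z.1 = dyadicCell (M + 1) z.2
    · exact (key _ h).trans le_self_add
    · refine ih.trans (le_trans ?_ le_add_self)
      rw [Finset.sum_range_succ, add_comm]
      gcongr
      simp [h]

theorem WpPow_le_sum {d : ℕ} {p : ℝ} (hp : 0 ≤ p) (μ ν : Measure (Fin d → ℝ))
    [IsProbabilityMeasure μ] [IsProbabilityMeasure ν] (hμ : ∀ᵐ x ∂μ, x ∈ unitBox d)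
    (hν : ∀ᵐ x ∂ν, x ∈ unitBox d) (M : ℕ) :
    WpPow p μ ν ≤ ENNReal.ofReal ((2 ^ (-p)) ^ M) +
      ∑ n ∈ Finset.range M, ENNReal.ofReal ((2 ^ (-p)) ^ n) *
        ∑' i, (μ (dyadicCell (n + 1) ⁻¹' {i}) - ν (dyadicCell (n + 1) ⁻¹' {i})) := by
  have h0 : ∀ x ∈ unitBox d, dyadicCell 0 x = 0 := by
    intro x hx
    ext i
    have := dyadicCell_lt 0 hx i
    rw [Pi.zero_apply]
    omega
  obtain ⟨ξ, h1, h2, h3⟩ := exists_nested_coupling μ ν dyadicCell measurable_dyadicCell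
    dyadicCell_eq_of_succ 0 (hμ.mono h0) (hν.mono h0) M
  have g1 : ∀ᵐ z ∂ξ, z.1 ∈ unitBox d :=
    ae_of_ae_map measurable_fst.aemeasurable (by rwa [h1])
  have g2 : ∀ᵐ z ∂ξ, z.2 ∈ unitBox d :=
    ae_of_ae_map measurable_snd.aemeasurable (by rwa [h2])
  have hξ : ξ Set.univ = 1 := by
    rw [← measure_univ (μ := μ), ← h1, Measure.map_apply measurable_fst MeasurableSet.univ,
      Set.preimage_univ]
  have hS : ∀ n, MeasurableSet {z : (Fin d → ℝ) × (Fin d → ℝ) |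
      dyadicCell n z.1 ≠ dyadicCell n z.2} := fun n =>
    (measurableSet_eq_fun ((measurable_dyadicCell n).comp measurable_fst)
      ((measurable_dyadicCell n).comp measurable_snd)).compl
  refine (iInf₂_le ξ ⟨h1, h2⟩).trans ?_
  refine (lintegral_mono_ae (g := fun z => ENNReal.ofReal ((2 ^ (-p)) ^ M) +
      ∑ n ∈ Finset.range M, ENNReal.ofReal ((2 ^ (-p)) ^ n) *
        {z | dyadicCell (n + 1) z.1 ≠ dyadicCell (n + 1) z.2}.indicator 1 z) ?_).trans ?_
  · filter_upwards [g1, g2] with z hz1 hz2 using nnnorm_sub_rpow_le hp hz1 hz2 M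
  · rw [lintegral_add_left measurable_const, lintegral_const, hξ, mul_one,
      lintegral_finsetSum _ fun n _ => (measurable_one.indicator (hS _)).const_mul _]
    gcongr with n hn
    rw [lintegral_const_mul _ (measurable_one.indicator (hS _)), lintegral_indicator_one (hS _)]
    gcongr
    exact h3 _ (Finset.mem_range.1 hn)

theorem empMeas_apply {d N : ℕ} (x : Fin N → Fin d → ℝ) {Q : Set (Fin d → ℝ)}
    (hQ : MeasurableSet Q) :
    empMeas N x Q = ENNReal.ofReal ((N : ℝ)⁻¹ * ∑ j, Q.indicator 1 (x j)) := by
  have h : ∀ j, Measure.dirac (x j) Q = ENNReal.ofReal (Q.indicator 1 (x j)) := by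
    intro j
    rw [Measure.dirac_apply' _ hQ]
    by_cases hj : x j ∈ Q <;> simp [hj]
  have h0 : ∀ j, (0 : ℝ) ≤ Q.indicator 1 (x j) := fun j =>
    Set.indicator_nonneg (fun _ _ => zero_le_one) _
  rcases Nat.eq_zero_or_pos N with rfl | hN
  · simp [empMeas]
  rw [ENNReal.ofReal_mul (by positivity), ENNReal.ofReal_sum_of_nonneg fun j _ => h0 j,
    ENNReal.ofReal_inv_of_pos (by exact_mod_cast hN), ENNReal.ofReal_natCast, empMeas]
  simp [h]

theorem isProbabilityMeasure_empMeas {d N : ℕ} (hN : 1 ≤ N) (x : Fin N → Fin d → ℝ) :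
    IsProbabilityMeasure (empMeas N x) := by
  refine ⟨?_⟩
  rw [empMeas_apply x MeasurableSet.univ]
  have : (N : ℝ) ≠ 0 := by positivity
  simp [this]

open ProbabilityTheory in
/-- The expected mass deficit of the empirical measure on a set `Q`; `t` is a free parameter. -/
theorem lintegral_measure_sub_empMeas_le {d N : ℕ} (hN : 1 ≤ N) (μ : Measure (Fin d → ℝ))
    [IsProbabilityMeasure μ] {Q : Set (Fin d → ℝ)} (hQ : MeasurableSet Q) {t : ℝ} (ht : 0 < t) :
    ∫⁻ x, (μ Q - empMeas N x Q) ∂(Measure.pi fun _ : Fin N => μ) ≤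
      ENNReal.ofReal ((t / N * μ.real Q + 1 / t) / 4) := by
  set P := Measure.pi fun _ : Fin N => μ
  set f : (Fin d → ℝ) → ℝ := Q.indicator 1 with hf
  set S : (Fin N → Fin d → ℝ) → ℝ := ∑ j, fun x => f (x j) with hS
  have hN0 : (0 : ℝ) < N := by exact_mod_cast hN
  have hfL : MemLp f 2 μ := memLp_indicator_const 2 hQ 1 (Or.inr (measure_ne_top _ _))
  have hfi : ∫ y, f y ∂μ = μ.real Q := by rw [hf, integral_indicator_one hQ]
  have hL : ∀ j, MemLp (fun x : Fin N → Fin d → ℝ => f (x j)) 2 P := fun j =>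
    hfL.comp_measurePreserving (measurePreserving_eval (fun _ : Fin N => μ) j)
  have hSL : MemLp S 2 P := memLp_finsetSum' _ fun j _ => hL j
  have hSi : Integrable S P := hSL.integrable (by norm_num)
  have hSm : ∫ x, S x ∂P = N * μ.real Q := by
    simp only [hS, Finset.sum_apply]
    rw [integral_finsetSum _ fun j _ => (hL j).integrable (by norm_num)]
    have : ∀ j, ∫ x, f (x j) ∂P = μ.real Q := by
      intro j
      rw [← hfi]
      exact integral_comp_eval (μ := fun _ : Fin N => μ) hfL.1
    simp [this]
  have hvarf : Var[f; μ] ≤ μ.real Q := by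
    refine (variance_le_expectation_sq hfL.1).trans ?_
    rw [← hfi]
    refine (integral_congr_ae (ae_of_all _ fun y => ?_)).le
    by_cases hy : y ∈ Q <;> simp [hf, hy]
  have hvar : Var[S; P] ≤ N * μ.real Q := by
    rw [variance_sum_pi fun _ => hfL]
    simpa using mul_le_mul_of_nonneg_left hvarf hN0.le
  have hvar2 : ∫ x, (S x - N * μ.real Q) ^ 2 ∂P ≤ N * μ.real Q := by
    rw [variance_eq_integral hSL.1.aemeasurable, hSm] at hvar
    exact hvar
  have hsq : Integrable (fun x => (S x - N * μ.real Q) ^ 2) P :=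
    (hSL.sub (memLp_const (N * μ.real Q))).integrable_sq
  have hlin : Integrable (fun x => N * μ.real Q - S x) P := (integrable_const _).sub hSi
  let g : (Fin N → Fin d → ℝ) → ℝ := fun x =>
    (1 / (2 * N)) * (N * μ.real Q - S x) +
      ((t / (4 * N ^ 2)) * (S x - N * μ.real Q) ^ 2 + 1 / (4 * t))
  have hquad : Integrable
      (fun x => (t / (4 * N ^ 2)) * (S x - N * μ.real Q) ^ 2 + 1 / (4 * t)) P :=
    (hsq.const_mul _).add (integrable_const _)
  have hg : Integrable g P := (hlin.const_mul _).add hquad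
  have hpt : ∀ x, max (μ.real Q - (N : ℝ)⁻¹ * S x) 0 ≤ g x := by
    intro x
    have e : g x = (t * (μ.real Q - (N : ℝ)⁻¹ * S x) + 1) ^ 2 / (4 * t) := by
      simp only [g]; field_simp; ring
    rw [e, max_le_iff]
    refine ⟨?_, by positivity⟩
    rw [le_div_iff₀ (by positivity)]
    nlinarith [sq_nonneg (t * (μ.real Q - (N : ℝ)⁻¹ * S x) - 1)]
  have hgi : ∫ x, g x ∂P ≤ (t / N * μ.real Q + 1 / t) / 4 := by
    have : ∫ x, g x ∂P = (t / (4 * N ^ 2)) * ∫ x, (S x - N * μ.real Q) ^ 2 ∂P + 1 / (4 * t) := by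
      simp only [g]
      rw [integral_add (hlin.const_mul _) hquad,
        integral_add (hsq.const_mul _) (integrable_const _), integral_const_mul,
        integral_const_mul, integral_sub (integrable_const _) hSi, hSm]
      simp
    rw [this]
    calc _ ≤ (t / (4 * N ^ 2)) * (N * μ.real Q) + 1 / (4 * t) := by gcongr
      _ = _ := by field_simp
  calc ∫⁻ x, (μ Q - empMeas N x Q) ∂P ≤ ∫⁻ x, ENNReal.ofReal (g x) ∂P := by
        refine lintegral_mono fun x => ?_
        have hSx : S x = ∑ j, Q.indicator 1 (x j) := by simp [hS, hf]
        have h0 : 0 ≤ (N : ℝ)⁻¹ * S x := by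
          rw [hSx]
          exact mul_nonneg (by positivity) (Finset.sum_nonneg fun j _ =>
            Set.indicator_nonneg (fun _ _ => zero_le_one) _)
        rw [empMeas_apply x hQ, ← hSx, ← ofReal_measureReal (μ := μ) (s := Q),
          ← ENNReal.ofReal_sub _ h0]
        exact ENNReal.ofReal_le_ofReal ((le_max_left _ _).trans (hpt x))
    _ = ENNReal.ofReal (∫ x, g x ∂P) :=
        (ofReal_integral_eq_lintegral_ofReal hg
          (ae_of_all _ fun x => (le_max_right _ _).trans (hpt x))).symm
    _ ≤ _ := ENNReal.ofReal_le_ofReal hgi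

theorem measurable_empMeas_apply {d N : ℕ} {Q : Set (Fin d → ℝ)} (hQ : MeasurableSet Q) :
    Measurable fun x : Fin N → Fin d → ℝ => empMeas N x Q := by
  simp_rw [empMeas_apply _ hQ]
  refine ENNReal.measurable_ofReal.comp (Measurable.const_mul ?_ _)
  exact Finset.measurable_sum _ fun j _ =>
    (measurable_one.indicator hQ).comp (measurable_pi_apply j)

theorem lintegral_tsum_dyadicCell_le {d N : ℕ} (hN : 1 ≤ N) (μ : Measure (Fin d → ℝ))
    [IsProbabilityMeasure μ] (hμ : ∀ᵐ x ∂μ, x ∈ unitBox d) (m : ℕ) :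
    ∫⁻ x, ∑' i, (μ (dyadicCell m ⁻¹' {i}) - empMeas N x (dyadicCell m ⁻¹' {i}))
        ∂(Measure.pi fun _ : Fin N => μ) ≤
      ENNReal.ofReal (√((2 ^ m) ^ d / N) / 2) := by
  have hQ : ∀ i : Fin d → ℕ, MeasurableSet (dyadicCell m ⁻¹' {i}) := fun i =>
    measurable_dyadicCell m (measurableSet_singleton i)
  have hN0 : (0 : ℝ) < N := by exact_mod_cast hN
  set F : Finset (Fin d → ℕ) := Fintype.piFinset fun _ => Finset.range (2 ^ m) with hF
  have hcard : (F.card : ℝ) = (2 ^ m) ^ d := by simp [hF]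
  have hnull : ∀ i ∉ F, μ (dyadicCell m ⁻¹' {i}) = 0 := by
    intro i hi
    refine measure_mono_null (t := (unitBox d)ᶜ) (fun x hx hbox => hi ?_) hμ
    rw [← show dyadicCell m x = i from hx, hF, Fintype.mem_piFinset]
    exact fun j => Finset.mem_range.2 (dyadicCell_lt m hbox j)
  have hsum : ∀ x : Fin N → Fin d → ℝ,
      ∑' i, (μ (dyadicCell m ⁻¹' {i}) - empMeas N x (dyadicCell m ⁻¹' {i})) =
        ∑ i ∈ F, (μ (dyadicCell m ⁻¹' {i}) - empMeas N x (dyadicCell m ⁻¹' {i})) := fun x =>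
    tsum_eq_sum fun i hi => by rw [hnull i hi, zero_tsub]
  have hone : ∑ i ∈ F, μ.real (dyadicCell m ⁻¹' {i}) ≤ 1 := by
    rw [← measureReal_biUnion_finset (fun i _ j _ hij => Disjoint.preimage _ (by simpa using hij))
      fun i _ => hQ i]
    exact measureReal_le_one
  set K : ℝ := (2 ^ m) ^ d with hK
  have hK0 : 0 < K := by positivity
  have ht : 0 < √(N * K) := Real.sqrt_pos.2 (by positivity)
  simp_rw [hsum]
  have hmeas : ∀ i, Measurable fun x : Fin N → Fin d → ℝ =>
      μ (dyadicCell m ⁻¹' {i}) - empMeas N x (dyadicCell m ⁻¹' {i}) := fun i =>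
    measurable_const.sub (measurable_empMeas_apply (hQ i))
  rw [lintegral_finsetSum _ fun i _ => hmeas i]
  refine (Finset.sum_le_sum fun i _ => lintegral_measure_sub_empMeas_le hN μ (hQ i) ht).trans ?_
  rw [← ENNReal.ofReal_sum_of_nonneg fun i _ => by positivity]
  refine ENNReal.ofReal_le_ofReal ?_
  rw [← Finset.sum_div, Finset.sum_add_distrib, ← Finset.mul_sum, Finset.sum_const,
    nsmul_eq_mul, hcard]
  calc _ ≤ (√(N * K) / N * 1 + K * (1 / √(N * K))) / 4 := by gcongr
    _ = √(K / N) / 2 := by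
      have e1 : √(N * K) = √N * √K := Real.sqrt_mul hN0.le _
      have e2 : √(K / N) = √K / √N := Real.sqrt_div hK0.le _
      have e3 : (N : ℝ) = √N * √N := (Real.mul_self_sqrt hN0.le).symm
      have e4 : K = √K * √K := (Real.mul_self_sqrt hK0.le).symm
      have hn : 0 < √(N : ℝ) := Real.sqrt_pos.2 hN0
      have hk : 0 < √K := Real.sqrt_pos.2 hK0
      rw [e1, e2]
      generalize √(N : ℝ) = a at *
      generalize √K = b at *
      rw [e3, e4]
      field_simp
      ring

theorem expWpPow_le_sum {d N : ℕ} {p : ℝ} (hp : 0 ≤ p) (hN : 1 ≤ N) (μ : Measure (Fin d → ℝ))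
    [IsProbabilityMeasure μ] (hμ : ∀ᵐ x ∂μ, x ∈ unitBox d) (M : ℕ) :
    expWpPow p μ N ≤ ENNReal.ofReal ((2 ^ (-p)) ^ M +
      ∑ n ∈ Finset.range M, (2 ^ (-p)) ^ n * (√((2 ^ (n + 1)) ^ d / N) / 2)) := by
  have hemp : ∀ᵐ x ∂(Measure.pi fun _ : Fin N => μ), ∀ᵐ y ∂(empMeas N x), y ∈ unitBox d := by
    have hb : MeasurableSet (unitBox d) := MeasurableSet.univ_pi fun _ => measurableSet_Ico
    have : ∀ᵐ x ∂(Measure.pi fun _ : Fin N => μ), ∀ j, x j ∈ unitBox d :=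
      ae_all_iff.2 fun j =>
        (measurePreserving_eval (fun _ : Fin N => μ) j).quasiMeasurePreserving.ae hμ
    filter_upwards [this] with x hx
    change empMeas N x (unitBox d)ᶜ = 0
    rw [empMeas_apply x hb.compl]
    simp [hx]
  have hmeas : ∀ n, Measurable fun x : Fin N → Fin d → ℝ =>
      ∑' i, (μ (dyadicCell n ⁻¹' {i}) - empMeas N x (dyadicCell n ⁻¹' {i})) := fun n =>
    Measurable.tsum fun i => measurable_const.sub
      (measurable_empMeas_apply (measurable_dyadicCell n (measurableSet_singleton i)))
  refine (lintegral_mono_ae (g := fun x => ENNReal.ofReal ((2 ^ (-p)) ^ M) +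
      ∑ n ∈ Finset.range M, ENNReal.ofReal ((2 ^ (-p)) ^ n) *
        ∑' i, (μ (dyadicCell (n + 1) ⁻¹' {i}) -
          empMeas N x (dyadicCell (n + 1) ⁻¹' {i}))) ?_).trans ?_
  · filter_upwards [hemp] with x hx
    have := isProbabilityMeasure_empMeas hN x
    exact WpPow_le_sum hp μ _ hμ hx M
  · rw [ENNReal.ofReal_add (by positivity) (Finset.sum_nonneg fun n _ => by positivity),
      ENNReal.ofReal_sum_of_nonneg fun n _ => by positivity,
      lintegral_add_left measurable_const, lintegral_const, measure_univ, mul_one,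
      lintegral_finsetSum _ fun n _ => (hmeas _).const_mul _]
    gcongr with n
    rw [lintegral_const_mul _ (hmeas _), ENNReal.ofReal_mul (by positivity)]
    gcongr
    exact lintegral_tsum_dyadicCell_le hN μ hμ (n + 1)

theorem one_le_diam_unitBox {d : ℕ} (hd : 0 < d) : 1 ≤ Metric.diam (unitBox d) := by
  have hb : Bornology.IsBounded (unitBox d) :=
    Bornology.IsBounded.pi fun _ => Metric.isBounded_Ico 0 1
  refine le_of_forall_lt fun c hc => ?_
  obtain ⟨e, he, he1⟩ := exists_between (max_lt hc zero_lt_one)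
  have he0 : 0 < e := (le_max_right _ _).trans_lt he
  have h := Metric.dist_le_diam_of_mem hb
    (show (fun _ => e) ∈ unitBox d from fun _ _ => ⟨he0.le, he1⟩)
    (show (fun _ => 0) ∈ unitBox d from fun _ _ => ⟨le_rfl, zero_lt_one⟩)
  have : Nonempty (Fin d) := ⟨⟨0, hd⟩⟩
  rw [dist_pi_const, Real.dist_eq, sub_zero, abs_of_pos he0] at h
  exact ((le_max_left _ _).trans_lt he).trans_le h

/-- The numerical bound obtained by stopping at the dyadic scale comparable to `N^(-1/d)`. -/
theorem exists_sum_le {d N : ℕ} {p : ℝ} (hp : 1 ≤ p) (hpd : 2 * p < d) (hN : 1 ≤ N) :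
    ∃ M : ℕ, (2 ^ (-p)) ^ M +
      ∑ n ∈ Finset.range M, (2 ^ (-p)) ^ n * (√((2 ^ (n + 1)) ^ d / N) / 2) ≤
      2 ^ (((d : ℝ) - 2) / 2) *
        (1 / (1 - (2 : ℝ) ^ (p - (d : ℝ) / 2)) + 1 / (1 - (2 : ℝ) ^ (-p))) *
        (N : ℝ) ^ (-p / d) := by
  have hN1 : (1 : ℝ) ≤ N := by exact_mod_cast hN
  have hd : (0 : ℝ) < d := by linarith
  set L : ℝ := (N : ℝ) ^ (1 / (d : ℝ)) with hL
  have hL1 : 1 ≤ L := Real.one_le_rpow hN1 (by positivity)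
  have hL0 : 0 < L := by linarith
  obtain ⟨m, hm1, hm2⟩ := exists_nat_pow_near hL1 (one_lt_two : (1 : ℝ) < 2)
  refine ⟨m + 1, ?_⟩
  have hNL : (N : ℝ) ^ (-p / d) = L ^ (-p) := by
    rw [hL, ← Real.rpow_mul (by positivity)]; congr 1; ring
  have hsN : √(N : ℝ) = L ^ ((d : ℝ) / 2) := by
    rw [hL, ← Real.rpow_mul (by positivity), Real.sqrt_eq_rpow]; congr 1; field_simp
  set C : ℝ := 2 ^ (((d : ℝ) - 2) / 2) with hC
  have hC1 : 1 ≤ C := Real.one_le_rpow one_le_two (by linarith)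
  set s : ℝ := 2 ^ ((d : ℝ) / 2 - p) with hs
  have hs1 : 1 < s := Real.one_lt_rpow one_lt_two (by linarith)
  have hsi : (2 : ℝ) ^ (p - (d : ℝ) / 2) = s⁻¹ := by
    rw [hs, ← Real.rpow_neg (by norm_num)]; congr 1; ring
  have hr1 : (2 : ℝ) ^ (-p) < 1 := Real.rpow_lt_one_of_one_lt_of_neg one_lt_two (by linarith)
  have hr0 : (0 : ℝ) < 2 ^ (-p) := by positivity
  have hB : 1 ≤ 1 / (1 - (2 : ℝ) ^ (-p)) := by
    rw [le_div_iff₀ (by linarith)]; linarith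
  have hLp : 0 < L ^ (-p) := by positivity
  have hfirst : ((2 : ℝ) ^ (-p)) ^ (m + 1) ≤ L ^ (-p) := by
    rw [Real.rpow_pow_comm two_pos.le]
    exact Real.rpow_le_rpow_of_nonpos hL0 hm2.le (by linarith)
  have hterm : ∀ n : ℕ, ((2 : ℝ) ^ (-p)) ^ n * (√((2 ^ (n + 1)) ^ d / N) / 2) =
      C * L ^ (-((d : ℝ) / 2)) * s ^ n := by
    intro n
    rw [Real.sqrt_div (by positivity), hsN, Real.rpow_neg hL0.le, hC, hs, Real.sqrt_eq_rpow]
    have : (2 : ℝ) ^ (-p) = 2 ^ ((d : ℝ) / 2 - p) * 2 ^ (-((d : ℝ) / 2)) := by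
      rw [← Real.rpow_add two_pos]; congr 1; ring
    rw [this, mul_pow]
    have e : ((2 : ℝ) ^ (-((d : ℝ) / 2))) ^ n * (((2 ^ (n + 1)) ^ d) ^ ((1 : ℝ) / 2)) / 2 =
        2 ^ (((d : ℝ) - 2) / 2) := by
      rw [← Real.rpow_natCast, ← Real.rpow_natCast _ d, ← Real.rpow_natCast _ (n + 1),
        ← Real.rpow_mul two_pos.le, ← Real.rpow_mul two_pos.le, ← Real.rpow_mul two_pos.le,
        ← Real.rpow_add two_pos]
      rw [div_eq_iff two_ne_zero, ← Real.rpow_add_one two_ne_zero]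
      congr 1
      push_cast
      ring
    rw [← e]
    ring
  have hgeom : ∑ n ∈ Finset.range (m + 1), s ^ n ≤ L ^ ((d : ℝ) / 2 - p) * (1 / (1 - s⁻¹)) := by
    have hsm : s ^ m ≤ L ^ ((d : ℝ) / 2 - p) := by
      rw [hs, Real.rpow_pow_comm two_pos.le]
      exact Real.rpow_le_rpow (by positivity) hm1 (by linarith)
    have hs2 : 0 < 1 - s⁻¹ := sub_pos.2 (inv_lt_one_of_one_lt₀ hs1)
    calc ∑ n ∈ Finset.range (m + 1), s ^ n ≤ s ^ m * (1 / (1 - s⁻¹)) := by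
          rw [geom_sum_eq hs1.ne', mul_one_div, div_le_div_iff₀ (by linarith) hs2]
          have : s ^ m * (s - 1) = s ^ (m + 1) * (1 - s⁻¹) := by
            field_simp
            ring
          rw [this]
          gcongr
          linarith
      _ ≤ _ := by gcongr
  simp_rw [hterm]
  rw [← Finset.mul_sum, hNL, hsi]
  calc _ ≤ L ^ (-p) + C * L ^ (-((d : ℝ) / 2)) * (L ^ ((d : ℝ) / 2 - p) * (1 / (1 - s⁻¹))) := by
        gcongr
    _ = L ^ (-p) + C * (1 / (1 - s⁻¹)) * L ^ (-p) := by
        have : L ^ (-p) = L ^ (-((d : ℝ) / 2)) * L ^ ((d : ℝ) / 2 - p) := by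
          rw [← Real.rpow_add hL0]; congr 1; ring
        rw [this]; ring
    _ ≤ _ := by
        have : 1 ≤ C * (1 / (1 - (2 : ℝ) ^ (-p))) := one_le_mul_of_one_le_of_one_le hC1 hB
        nlinarith

/-- For `1 ≤ p < d/2`, any probability measure `μ` on the unit cube `[0,1)^d` and any
`N ≥ 1`, `E[ρ_p^p(μ, μ̂_N)]^{1/p} ≤ κ N^{−1/d}` with the explicit constant
`κ = 𝔡 · 2^{(d−2)/(2p)} · (1/(1 − 2^{p−d/2}) + 1/(1 − 2^{−p}))^{1/p}`,
where `𝔡` is the diameter of `[0,1)^d`. -/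
theorem empirical_quantization_cube {d : ℕ} (p : ℝ) (hp : 1 ≤ p) (hpd : 2 * p < d)
    (μ : Measure (Fin d → ℝ)) [IsProbabilityMeasure μ] (hμ : μ (unitBox d)ᶜ = 0)
    (N : ℕ) (hN : 1 ≤ N) :
    (expWpPow p μ N) ^ (1 / p) ≤
      ENNReal.ofReal ((Metric.diam (unitBox d) * 2 ^ (((d : ℝ) - 2) / (2 * p)) *
          (1 / (1 - (2 : ℝ) ^ (p - (d : ℝ) / 2)) + 1 / (1 - (2 : ℝ) ^ (-p))) ^ (1 / p)) *
        (N : ℝ) ^ (-(1 : ℝ) / d)) := by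
  have hμ' : ∀ᵐ x ∂μ, x ∈ unitBox d := hμ
  have hd : (0 : ℝ) < d := by linarith
  have hp0 : 0 < p := by linarith
  have hN0 : (0 : ℝ) < N := by exact_mod_cast hN
  obtain ⟨M, hM⟩ := exists_sum_le hp hpd hN
  have hdiam := one_le_diam_unitBox (d := d) (by exact_mod_cast hd)
  have hA : (0 : ℝ) < 1 - 2 ^ (p - (d : ℝ) / 2) :=
    sub_pos.2 (Real.rpow_lt_one_of_one_lt_of_neg one_lt_two (by linarith))
  have hB : (0 : ℝ) < 1 - 2 ^ (-p) :=
    sub_pos.2 (Real.rpow_lt_one_of_one_lt_of_neg one_lt_two (by linarith))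
  refine (ENNReal.rpow_le_rpow ((expWpPow_le_sum hp0.le hN μ hμ' M).trans
    (ENNReal.ofReal_le_ofReal hM)) (by positivity)).trans ?_
  rw [ENNReal.ofReal_rpow_of_nonneg (by positivity) (by positivity)]
  refine ENNReal.ofReal_le_ofReal ?_
  rw [Real.mul_rpow (by positivity) (by positivity), Real.mul_rpow (by positivity) (by positivity),
    ← Real.rpow_mul two_pos.le, ← Real.rpow_mul hN0.le]
  have e1 : ((d : ℝ) - 2) / 2 * (1 / p) = ((d : ℝ) - 2) / (2 * p) := by field_simp
  have e2 : -p / (d : ℝ) * (1 / p) = -(1 : ℝ) / d := by field_simp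
  rw [e1, e2, mul_assoc (Metric.diam _), mul_assoc (Metric.diam _)]
  exact le_mul_of_one_le_left (by positivity) hdiam
end

section
/- Let d ≥ 3 and 1 ≤ p < d/2. Let U denote the uniform distribution on [0,1)^d and Û_N the empirical measure of N i.i.d. U-distributed points. Then the limit lim_{N→∞} N^{1/d} · E[ρ_p^p(U, Û_N)]^{1/p} exists in (0, ∞). -/
open MeasureTheory ENNReal

/-- The mean of `g` under the binomial distribution with `N` trials and success probability `q`. -/
noncomputable def binMean (q : ℝ) : ℕ → (ℕ → ℝ) → ℝ
  | 0, g => g 0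
  | N + 1, g => q * binMean q N (fun n => g (n + 1)) + (1 - q) * binMean q N g

namespace binMean

lemma one (N : ℕ) (g : ℕ → ℝ) : binMean 1 N g = g N := by
  induction N generalizing g with
  | zero => rfl
  | succ N ih => simp [binMean, ih]

lemma add (q : ℝ) (N : ℕ) (g h : ℕ → ℝ) :
    binMean q N (fun n => g n + h n) = binMean q N g + binMean q N h := by
  induction N generalizing g h with
  | zero => rfl
  | succ N ih => simp only [binMean, ih]; ring

lemma const_mul (q c : ℝ) (N : ℕ) (g : ℕ → ℝ) :
    binMean q N (fun n => c * g n) = c * binMean q N g := by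
  induction N generalizing g with
  | zero => rfl
  | succ N ih => simp only [binMean, ih]; ring

lemma const (q c : ℝ) (N : ℕ) : binMean q N (fun _ => c) = c := by
  induction N with
  | zero => rfl
  | succ N ih => simp only [binMean, ih]; ring

lemma mono {q : ℝ} (h0 : 0 ≤ q) (h1 : q ≤ 1) (N : ℕ) {g h : ℕ → ℝ} (hgh : ∀ n, g n ≤ h n) :
    binMean q N g ≤ binMean q N h := by
  induction N generalizing g h with
  | zero => exact hgh 0
  | succ N ih =>
    have h1' : 0 ≤ 1 - q := by linarith
    simp only [binMean]
    have e1 := ih hgh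
    have e2 := ih (g := fun n => g (n + 1)) (h := fun n => h (n + 1)) fun n => hgh _
    gcongr

lemma comp (q r : ℝ) (N : ℕ) (g : ℕ → ℝ) :
    binMean q N (fun n => binMean r n g) = binMean (q * r) N g := by
  induction N generalizing g with
  | zero => rfl
  | succ N ih =>
    have e : (fun n => binMean r (n + 1) g) = fun n =>
        r * binMean r n (fun n => g (n + 1)) + (1 - r) * binMean r n g := rfl
    simp only [binMean]
    rw [add, const_mul, const_mul, ih, ih]
    ring

lemma id (q : ℝ) (N : ℕ) : binMean q N (fun n => (n : ℝ)) = q * N := by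
  induction N with
  | zero => simp [binMean]
  | succ N ih =>
    simp only [binMean, Nat.cast_add, Nat.cast_one]
    rw [add, const, ih]
    ring

lemma sq_sub (q c : ℝ) (N : ℕ) :
    binMean q N (fun n => ((n : ℝ) - c) ^ 2) = (q * N - c) ^ 2 + q * (1 - q) * N := by
  induction N generalizing c with
  | zero => simp [binMean]
  | succ N ih =>
    simp only [binMean, Nat.cast_add, Nat.cast_one]
    have e : (fun n : ℕ => ((n : ℝ) + 1 - c) ^ 2) = fun n : ℕ => ((n : ℝ) - (c - 1)) ^ 2 := by
      funext n; ring
    rw [e, ih, ih]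
    ring

lemma sq_sub_le {q : ℝ} (h0 : 0 ≤ q) (c : ℝ) (N : ℕ) :
    binMean q N (fun n => ((n : ℝ) - c) ^ 2) ≤ (q * N - c) ^ 2 + q * N := by
  rw [sq_sub]
  have : 0 ≤ q * q * N := by positivity
  nlinarith

lemma sqrt_le {q : ℝ} (h0 : 0 ≤ q) (h1 : q ≤ 1) (N : ℕ) :
    binMean q N (fun n => √(n : ℝ)) ≤ √(q * N) := by
  rcases (by positivity : 0 ≤ q * N).eq_or_lt with h | h
  · have : binMean q N (fun n => √(n : ℝ)) ≤ binMean q N (fun n => (n : ℝ)) := by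
      apply mono h0 h1
      intro n
      rw [Real.sqrt_le_left (by positivity)]
      exact_mod_cast Nat.le_self_pow two_ne_zero n
    rw [id, ← h] at this
    simpa [← h] using this
  · set s := √(q * N) with hs
    have hs0 : 0 < s := Real.sqrt_pos.2 h
    have hss : s * s = q * N := Real.mul_self_sqrt h.le
    have : binMean q N (fun n => √(n : ℝ)) ≤ binMean q N (fun n => s / 2 + 1 / (2 * s) * n) := by
      apply mono h0 h1
      intro n
      have e : s / 2 + 1 / (2 * s) * (n : ℝ) - √n = (s - √n) ^ 2 / (2 * s) := by
        have := Real.sq_sqrt (Nat.cast_nonneg (α := ℝ) n)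
        field_simp
        linear_combination -this
      have : 0 ≤ (s - √n) ^ 2 / (2 * s) := by positivity
      linarith
    rw [add, const, const_mul, id, ← hss] at this
    have e : s / 2 + 1 / (2 * s) * (s * s) = s := by field_simp; norm_num
    linarith

lemma abs_sub_le {q : ℝ} (h0 : 0 ≤ q) (h1 : q ≤ 1) (N : ℕ) :
    binMean q N (fun n => |(n : ℝ) - q * N|) ≤ √(q * N) := by
  set s := √(q * N) with hs
  have hss : s * s = q * N := Real.mul_self_sqrt (by positivity)
  rcases (Real.sqrt_nonneg (q * N)).eq_or_lt with h | h
  · have hz : q * N = 0 := by rw [← hss, hs, ← h]; simp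
    have : binMean q N (fun n => |(n : ℝ) - q * N|) ≤ binMean q N (fun n => (n : ℝ)) := by
      apply mono h0 h1
      intro n
      simp [hz]
    rw [id, hz] at this
    simpa [hs, hz] using this
  · have hs0 : 0 < s := h
    have : binMean q N (fun n => |(n : ℝ) - q * N|) ≤
        binMean q N (fun n => s / 2 + 1 / (2 * s) * ((n : ℝ) - q * N) ^ 2) := by
      apply mono h0 h1
      intro n
      set t := (n : ℝ) - q * N
      have e : s / 2 + 1 / (2 * s) * t ^ 2 - |t| = (s - |t|) ^ 2 / (2 * s) := by
        rw [← sq_abs t]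
        field_simp
        ring
      have : 0 ≤ (s - |t|) ^ 2 / (2 * s) := by positivity
      linarith
    have h2 := sq_sub_le h0 (q * N) N
    rw [sub_self] at h2
    rw [add, const, const_mul] at this
    have e : s / 2 + 1 / (2 * s) * (s * s) = s := by field_simp; norm_num
    have h3 : 1 / (2 * s) * binMean q N (fun n => ((n : ℝ) - q * N) ^ 2) ≤
        1 / (2 * s) * (s * s) := by
      gcongr
      rw [hss]; linarith
    linarith

end binMean

/-- A self-improving bound of `g` by its binomial means, with an error of order `√N`. -/
def BinBound (g : ℕ → ℝ) (P q E : ℝ) : Prop :=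
  ∀ N : ℕ, g N ≤ P * binMean q N g + E * √(N : ℝ)

lemma BinBound.comp {g : ℕ → ℝ} {P q E P' q' E' : ℝ} (h : BinBound g P q E)
    (h' : BinBound g P' q' E') (hP : 0 ≤ P) (hE' : 0 ≤ E') (h0 : 0 ≤ q) (h1 : q ≤ 1) :
    BinBound g (P * P') (q * q') (E + P * √q * E') := by
  intro N
  have e1 : binMean q N g ≤ binMean q N (fun n => P' * binMean q' n g + E' * √(n : ℝ)) :=
    binMean.mono h0 h1 N h'
  rw [binMean.add, binMean.const_mul, binMean.const_mul, binMean.comp] at e1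
  have e2 := binMean.sqrt_le h0 h1 N
  rw [Real.sqrt_mul h0] at e2
  calc g N ≤ P * binMean q N g + E * √(N : ℝ) := h N
    _ ≤ P * (P' * binMean (q * q') N g + E' * (√q * √N)) + E * √(N : ℝ) := by
      gcongr
      exact e1.trans (by gcongr)
    _ = _ := by ring

/-- Iterating the dyadic bound. -/
lemma BinBound.two_pow {d : ℕ} {α β : ℝ} (hβ : 0 < β) (hαβ : α = β + d / 2) {g : ℕ → ℝ}
    (h : BinBound g ((2 : ℝ) ^ α) ((2 : ℝ) ^ d)⁻¹ √((2 : ℝ) ^ d)) :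
    ∃ A : ℝ, 0 ≤ A ∧ ∀ L : ℕ,
      BinBound g (((2 : ℝ) ^ L) ^ α) (((2 : ℝ) ^ L) ^ d)⁻¹ (A * ((2 : ℝ) ^ L) ^ β) := by
  have h2 : 1 < (2 : ℝ) ^ β := Real.one_lt_rpow (by norm_num) hβ
  have h2' : 0 < (2 : ℝ) ^ β - 1 := by linarith
  refine ⟨√((2 : ℝ) ^ d) / ((2 : ℝ) ^ β - 1), by positivity, fun L => ?_⟩
  set A := √((2 : ℝ) ^ d) / ((2 : ℝ) ^ β - 1) with hA
  have hA0 : 0 ≤ A := by positivity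
  have hAe : A * ((2 : ℝ) ^ β - 1) = √((2 : ℝ) ^ d) := by rw [hA]; field_simp
  induction L with
  | zero =>
    intro N
    simp only [pow_zero, Real.one_rpow, one_pow, inv_one, binMean.one]
    have : 0 ≤ A * 1 * √(N : ℝ) := by positivity
    linarith
  | succ L ih =>
    have key := ih.comp h (by positivity) (by positivity) (by positivity)
      (inv_le_one_of_one_le₀ (one_le_pow₀ (one_le_pow₀ (by norm_num))))
    have e1 : (((2 : ℝ) ^ L) ^ α) * 2 ^ α = ((2 : ℝ) ^ (L + 1)) ^ α := by
      rw [pow_succ, Real.mul_rpow (by positivity) (by positivity)]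
    have e2 : (((2 : ℝ) ^ L) ^ d)⁻¹ * ((2 : ℝ) ^ d)⁻¹ = (((2 : ℝ) ^ (L + 1)) ^ d)⁻¹ := by
      rw [pow_succ, mul_pow, mul_inv]
    have e3 : ((2 : ℝ) ^ L) ^ α * √((((2 : ℝ) ^ L) ^ d)⁻¹) = ((2 : ℝ) ^ L) ^ β := by
      rw [Real.sqrt_eq_rpow, ← Real.rpow_natCast _ d, ← Real.rpow_neg (by positivity),
        ← Real.rpow_mul (by positivity), ← Real.rpow_add (by positivity), hαβ]
      congr 1; ring
    rw [e1, e2, e3, ← hAe] at key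
    convert key using 1
    rw [pow_succ, Real.mul_rpow (by positivity) (by positivity)]
    ring

/-- The scales `K * 2 ^ L` at which the bound holds are multiplicatively dense near infinity. -/
lemma BinBound.exists_scale {d : ℕ} (hd : 0 < d) {α β : ℝ} (hβ : 0 < β) (hαβ : α = β + d / 2)
    {g : ℕ → ℝ}
    (h : ∀ k : ℕ, 1 ≤ k → BinBound g ((k : ℝ) ^ α) ((k : ℝ) ^ d)⁻¹ √((k : ℝ) ^ d)) :
    ∃ A : ℝ, 0 ≤ A ∧ ∀ r : ℝ, 0 < r → r < 1 → ∃ Z : ℝ, ∀ z : ℝ, Z ≤ z → ∃ k : ℝ, 1 ≤ k ∧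
      r * z ≤ k ^ d ∧ k ^ d ≤ z ∧ BinBound g (k ^ α) (k ^ d)⁻¹ (A * k ^ β) := by
  obtain ⟨A, hA, hL⟩ := BinBound.two_pow hβ hαβ (by simpa using h 2 (by norm_num))
  refine ⟨A + 1, by positivity, fun r hr0 hr1 => ?_⟩
  set ρ : ℝ := r ^ ((d : ℝ)⁻¹)
  have hρ0 : 0 < ρ := by positivity
  have hρ1 : ρ < 1 := Real.rpow_lt_one hr0.le hr1 (by positivity)
  have hρd : ρ ^ d = r := Real.rpow_inv_natCast_pow hr0.le hd.ne'
  obtain ⟨s, hs⟩ := exists_pow_lt_of_lt_one (sub_pos.2 hρ1) (show (1 / 2 : ℝ) < 1 by norm_num)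
  obtain ⟨L₀, hL₀⟩ := pow_unbounded_of_one_lt (√(((2 : ℝ) ^ (s + 1)) ^ d))
    (Real.one_lt_rpow (show (1 : ℝ) < 2 by norm_num) hβ)
  refine ⟨((2 : ℝ) ^ s * 2 ^ (L₀ + 1)) ^ d, fun z hz => ?_⟩
  have hz0 : 0 ≤ z := le_trans (by positivity) hz
  set y : ℝ := z ^ ((d : ℝ)⁻¹)
  have hy0 : 0 ≤ y := by positivity
  have hyd : y ^ d = z := Real.rpow_inv_natCast_pow hz0 hd.ne'
  have hy : (2 : ℝ) ^ s * 2 ^ (L₀ + 1) ≤ y := by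
    rw [← hyd] at hz
    exact le_of_pow_le_pow_left₀ hd.ne' hy0 hz
  have h2s : (0 : ℝ) < 2 ^ s := by positivity
  have hy' : (2 : ℝ) ^ (L₀ + 1) ≤ y / 2 ^ s := by
    rw [le_div_iff₀ h2s]; linarith
  obtain ⟨L, hL1, hL2⟩ := exists_nat_pow_near
    (le_trans (one_le_pow₀ (by norm_num)) hy') (show (1 : ℝ) < 2 by norm_num)
  have hLL : L₀ ≤ L := by
    have := lt_of_le_of_lt hy' hL2
    have := (pow_lt_pow_iff_right₀ (show (1 : ℝ) < 2 by norm_num)).1 this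
    omega
  rw [le_div_iff₀ h2s] at hL1
  rw [div_lt_iff₀ h2s] at hL2
  have h2L : (0 : ℝ) < 2 ^ L := by positivity
  set K : ℕ := ⌊y / 2 ^ L⌋₊
  have hK1 : (K : ℝ) ≤ y / 2 ^ L := Nat.floor_le (by positivity)
  have hK2 : y / 2 ^ L < K + 1 := Nat.lt_floor_add_one _
  have hKs : 2 ^ s ≤ K := by
    apply Nat.le_floor
    push_cast
    rw [le_div_iff₀ h2L]; linarith
  have hK0 : 1 ≤ K := le_trans Nat.one_le_two_pow hKs
  have hK0' : (1 : ℝ) ≤ K := by exact_mod_cast hK0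
  have hKpos : (0 : ℝ) < K := by linarith
  have h1L : (1 : ℝ) ≤ 2 ^ L := one_le_pow₀ (by norm_num)
  rw [le_div_iff₀ h2L] at hK1
  rw [div_lt_iff₀ h2L] at hK2
  have hKu : (K : ℝ) ≤ 2 ^ (s + 1) := by
    have : (K : ℝ) * 2 ^ L < 2 ^ (s + 1) * 2 ^ L := by
      calc (K : ℝ) * 2 ^ L ≤ y := hK1
        _ < _ := hL2
        _ = _ := by ring
    exact (lt_of_mul_lt_mul_right this h2L.le).le
  refine ⟨K * 2 ^ L, one_le_mul_of_one_le_of_one_le hK0' h1L, ?_, ?_, ?_⟩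
  · rw [← hρd, ← hyd, ← mul_pow]
    refine pow_le_pow_left₀ (by positivity) ?_ d
    have : (2 : ℝ) ^ L ≤ y * (1 / 2) ^ s := by
      rw [one_div, inv_pow, ← div_eq_mul_inv, le_div_iff₀ h2s]; exact hL1
    have : y * (1 / 2) ^ s ≤ y * (1 - ρ) := by gcongr
    linarith
  · rw [← hyd]
    gcongr
  · have key := (h K hK0).comp (hL L) (by positivity) (by positivity) (by positivity)
      (inv_le_one_of_one_le₀ (one_le_pow₀ hK0'))
    rw [← Real.mul_rpow (by positivity) (by positivity), ← mul_inv, ← mul_pow] at key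
    have e3 : (K : ℝ) ^ α * √(((K : ℝ) ^ d)⁻¹) = (K : ℝ) ^ β := by
      rw [Real.sqrt_eq_rpow, ← Real.rpow_natCast _ d, ← Real.rpow_neg (by positivity),
        ← Real.rpow_mul (by positivity), ← Real.rpow_add (by positivity), hαβ]
      congr 1; ring
    rw [e3] at key
    intro N
    refine (key N).trans ?_
    gcongr
    rw [Real.mul_rpow (by positivity) (by positivity)]
    have e4 : √((K : ℝ) ^ d) ≤ ((2 : ℝ) ^ L) ^ β := by
      calc √((K : ℝ) ^ d) ≤ √(((2 : ℝ) ^ (s + 1)) ^ d) := by gcongr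
        _ ≤ ((2 : ℝ) ^ β) ^ L₀ := hL₀.le
        _ ≤ ((2 : ℝ) ^ β) ^ L := by
          gcongr
          exact (Real.one_lt_rpow (by norm_num) hβ).le
        _ = ((2 : ℝ) ^ L) ^ β := by
          rw [← Real.rpow_natCast, ← Real.rpow_natCast, ← Real.rpow_mul (by norm_num),
            ← Real.rpow_mul (by norm_num), mul_comm]
    have e5 : ((2 : ℝ) ^ L) ^ β ≤ (K : ℝ) ^ β * ((2 : ℝ) ^ L) ^ β :=
      le_mul_of_one_le_left (by positivity) (Real.one_le_rpow hK0' hβ.le)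
    linarith

lemma BinBound.div_rpow_le {d : ℕ} {α β a : ℝ} (hαβ : α = β + d / 2)
    (ha : d * a = α) {g : ℕ → ℝ} {A k l : ℝ} (hk : 1 ≤ k) (hl : 0 < l) {N : ℕ}
    (hN : l * k ^ d = N) (h : BinBound g (k ^ α) (k ^ d)⁻¹ (A * k ^ β)) :
    g N / (N : ℝ) ^ a ≤ binMean (k ^ d)⁻¹ N g / l ^ a + A * l ^ (1 / 2 - a) := by
  have hk0 : 0 < k := by linarith
  have e1 : (N : ℝ) ^ a = l ^ a * k ^ α := by
    rw [← hN, Real.mul_rpow hl.le (by positivity), ← Real.rpow_natCast k d,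
      ← Real.rpow_mul hk0.le, ha]
  have e2 : k ^ β * √(N : ℝ) = k ^ α * (l ^ a * l ^ (1 / 2 - a)) := by
    rw [← hN, Real.sqrt_mul hl.le, Real.sqrt_eq_rpow, Real.sqrt_eq_rpow, ← Real.rpow_natCast k d,
      ← Real.rpow_mul hk0.le, ← Real.rpow_add hl, hαβ, Real.rpow_add hk0]
    ring_nf
  rw [e1, div_le_iff₀ (by positivity)]
  calc g N ≤ _ := h N
    _ = k ^ α * binMean (k ^ d)⁻¹ N g + A * (k ^ α * (l ^ a * l ^ (1 / 2 - a))) := by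
      rw [← e2]; ring
    _ = _ := by field_simp

lemma abs_rpow_le {a s t : ℝ} (ha0 : 0 ≤ a) (ha2 : a ≤ 2) (hs : 0 < s) :
    |t| ^ a ≤ s ^ a * (1 + t ^ 2 / s ^ 2) := by
  rcases le_total |t| s with h | h
  · calc |t| ^ a ≤ s ^ a := by gcongr
      _ ≤ _ := le_mul_of_one_le_right (by positivity) (by
        have : 0 ≤ t ^ 2 / s ^ 2 := by positivity
        linarith)
  · have h1 : 1 ≤ |t| / s := by rwa [le_div_iff₀ hs, one_mul]
    have e : |t| = s * (|t| / s) := by field_simp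
    rw [e, Real.mul_rpow hs.le (by positivity)]
    gcongr
    calc (|t| / s) ^ a ≤ (|t| / s) ^ (2 : ℝ) := Real.rpow_le_rpow_of_exponent_le h1 ha2
      _ = t ^ 2 / s ^ 2 := by rw [Real.rpow_two, div_pow, sq_abs]
      _ ≤ _ := by linarith

lemma binMean_le_of_subadditive {a C : ℝ} (ha0 : 0 ≤ a) (ha2 : a ≤ 2) (hC : 0 ≤ C) {g : ℕ → ℝ}
    (g0 : ∀ n, 0 ≤ g n) (hg : ∀ n, g n ≤ C * (n : ℝ) ^ a) (hsub : ∀ m n, g (m + n) ≤ g m + g n)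
    {δ : ℝ} (hδ : 0 < δ) (hδ1 : δ ≤ 1) {n : ℕ} (hn : 1 ≤ n) {q : ℝ} {N : ℕ} (hq0 : 0 ≤ q)
    (hq1 : q ≤ 1) (hl : (1 + δ) * n ≤ q * N) (hu : q * N ≤ (1 + 2 * δ) * n) :
    binMean q N g ≤ g n + C * (n : ℝ) ^ a *
      (δ ^ a * (5 + 3 / (δ ^ 2 * n)) + 3 / (δ ^ 2 * n)) := by
  have hn0 : (0 : ℝ) < n := by exact_mod_cast hn
  set l := q * N with hldef
  have hδn : 0 < δ * n := by positivity
  have hln : δ * n ≤ l - n := by linarith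
  have hln0 : 0 < l - n := by linarith
  have hpt : ∀ j : ℕ, g j ≤ (g n + C * (δ * n) ^ a) +
      (C * (δ * n) ^ a / (δ * n) ^ 2 * ((j : ℝ) - n) ^ 2 +
        C * (n : ℝ) ^ a / (l - n) ^ 2 * ((j : ℝ) - l) ^ 2) := by
    intro j
    have hp1 : 0 ≤ C * (n : ℝ) ^ a / (l - n) ^ 2 * ((j : ℝ) - l) ^ 2 := by positivity
    have hp2 : 0 ≤ C * (δ * n) ^ a / (δ * n) ^ 2 * ((j : ℝ) - n) ^ 2 := by positivity
    have hp3 : 0 ≤ C * (δ * n) ^ a := by positivity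
    rcases le_or_gt n j with h | h
    · obtain ⟨i, rfl⟩ := Nat.exists_eq_add_of_le h
      have h1 := hsub n i
      have h2 := hg i
      have h3 := abs_rpow_le (t := (i : ℝ)) ha0 ha2 hδn
      rw [Nat.abs_cast] at h3
      have h4 : C * (i : ℝ) ^ a ≤ C * ((δ * n) ^ a * (1 + (i : ℝ) ^ 2 / (δ * n) ^ 2)) := by
        gcongr
      have h5 : C * ((δ * n) ^ a * (1 + (i : ℝ) ^ 2 / (δ * n) ^ 2)) = C * (δ * n) ^ a +
          C * (δ * n) ^ a / (δ * n) ^ 2 * (((n + i : ℕ) : ℝ) - n) ^ 2 := by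
        push_cast; ring
      linarith
    · have hjn : (j : ℝ) < n := by exact_mod_cast h
      have h1 : g j ≤ C * (n : ℝ) ^ a := (hg j).trans (by gcongr)
      have h2 : C * (n : ℝ) ^ a ≤ C * (n : ℝ) ^ a / (l - n) ^ 2 * ((j : ℝ) - l) ^ 2 := by
        rw [div_mul_eq_mul_div, le_div_iff₀ (by positivity)]
        gcongr _ * ?_
        nlinarith
      have := g0 n
      linarith
  have h1 := binMean.mono hq0 hq1 N hpt
  rw [binMean.add, binMean.const, binMean.add, binMean.const_mul, binMean.const_mul] at h1
  have h2 := binMean.sq_sub_le hq0 (n : ℝ) N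
  have h3 := binMean.sq_sub_le hq0 l N
  rw [← hldef] at h2 h3
  have hl3 : l ≤ 3 * n := by nlinarith
  have h2' : binMean q N (fun j => ((j : ℝ) - n) ^ 2) ≤ (δ * n) ^ 2 * (4 + 3 / (δ ^ 2 * n)) := by
    have e : (δ * n) ^ 2 * (4 + 3 / (δ ^ 2 * n)) = (2 * δ * n) ^ 2 + 3 * n := by
      field_simp; ring
    have : (l - n) ^ 2 ≤ (2 * δ * n) ^ 2 := by gcongr; linarith
    linarith
  have h3' : binMean q N (fun j => ((j : ℝ) - l) ^ 2) ≤ (l - n) ^ 2 * (3 / (δ ^ 2 * n)) := by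
    have e : (δ * n) ^ 2 * (3 / (δ ^ 2 * n)) = 3 * n := by
      field_simp
    have : (δ * n) ^ 2 * (3 / (δ ^ 2 * n)) ≤ (l - n) ^ 2 * (3 / (δ ^ 2 * n)) := by gcongr
    rw [sub_self] at h3
    linarith
  calc binMean q N g ≤ _ := h1
    _ ≤ g n + C * (δ * n) ^ a +
      (C * (δ * n) ^ a / (δ * n) ^ 2 * ((δ * n) ^ 2 * (4 + 3 / (δ ^ 2 * n))) +
        C * (n : ℝ) ^ a / (l - n) ^ 2 * ((l - n) ^ 2 * (3 / (δ ^ 2 * n)))) := by gcongr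
    _ = _ := by
      rw [Real.mul_rpow hδ.le hn0.le]
      field_simp
      ring

open Filter Topology in
theorem tendsto_div_rpow_of_binBound {d : ℕ} (hd : 0 < d) {p : ℝ} (hp : 0 < p) (hpd : 2 * p < d)
    {g : ℕ → ℝ} (g0 : ∀ n, 0 ≤ g n) (hgle : ∀ n, g n ≤ n) (hsub : ∀ m n, g (m + n) ≤ g m + g n)
    (h : ∀ k : ℕ, 1 ≤ k → BinBound g ((k : ℝ) ^ (d - p)) ((k : ℝ) ^ d)⁻¹ √((k : ℝ) ^ d)) :
    ∃ κ : ℝ, Tendsto (fun N : ℕ => g N / (N : ℝ) ^ (1 - p / d)) atTop (𝓝 κ) := by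
  have hd0 : (0 : ℝ) < d := by exact_mod_cast hd
  set a : ℝ := 1 - p / d with ha
  have hpd' : p / d < 1 / 2 := by rw [div_lt_div_iff₀ hd0 two_pos]; linarith
  have hpd0 : 0 < p / d := by positivity
  have ha1 : 1 / 2 < a := by linarith
  have ha0 : 0 < a := by linarith
  have ha2 : a < 1 := by linarith
  have hαβ : (d : ℝ) - p = (d / 2 - p) + d / 2 := by ring
  have hda : (d : ℝ) * a = d - p := by rw [ha]; field_simp
  obtain ⟨A, hA, hscale⟩ := BinBound.exists_scale hd (show 0 < (d : ℝ) / 2 - p by linarith) hαβ h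
  -- boundedness
  obtain ⟨C, hC, hgC⟩ : ∃ C : ℝ, 0 ≤ C ∧ ∀ n, g n ≤ C * (n : ℝ) ^ a := by
    obtain ⟨Z, hZ⟩ := hscale (1 / 2) (by norm_num) (by norm_num)
    refine ⟨|Z| + (2 + A), by positivity, fun n => ?_⟩
    rcases Nat.eq_zero_or_pos n with rfl | hn
    · have := hgle 0
      simp only [Nat.cast_zero] at this ⊢
      rw [Real.zero_rpow ha0.ne']
      linarith
    have hn1 : (1 : ℝ) ≤ n := by exact_mod_cast hn
    have hna : 1 ≤ (n : ℝ) ^ a := Real.one_le_rpow hn1 ha0.le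
    rcases lt_or_ge (n : ℝ) Z with hnZ | hnZ
    · calc g n ≤ n := hgle n
        _ ≤ |Z| + (2 + A) := by have := le_abs_self Z; linarith
        _ ≤ _ := le_mul_of_one_le_right (by positivity) hna
    · obtain ⟨k, hk, hk1, hk2, hb⟩ := hZ n hnZ
      have hkd : 0 < k ^ d := by positivity
      have hl1 : 1 ≤ n / k ^ d := by rw [le_div_iff₀ hkd]; linarith
      have hl2 : n / k ^ d ≤ 2 := by rw [div_le_iff₀ hkd]; linarith
      have := hb.div_rpow_le hαβ hda hk (l := n / k ^ d) (by positivity) (by field_simp)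
      rw [div_le_iff₀ (by positivity)] at this
      refine this.trans ?_
      gcongr ?_ * _
      have e1 : binMean (k ^ d)⁻¹ n g ≤ 2 := by
        have := binMean.mono (inv_nonneg.2 hkd.le) (inv_le_one_of_one_le₀ (one_le_pow₀ hk)) n hgle
        rw [binMean.id, inv_mul_eq_div] at this
        linarith
      have e2 : binMean (k ^ d)⁻¹ n g / (n / k ^ d) ^ a ≤ 2 := by
        rw [div_le_iff₀ (by positivity)]
        have := Real.one_le_rpow hl1 ha0.le
        linarith
      have e3 : A * (n / k ^ d) ^ (1 / 2 - a) ≤ A :=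
        mul_le_of_le_one_right hA (Real.rpow_le_one_of_one_le_of_nonpos hl1 (by linarith))
      have := abs_nonneg Z
      linarith
  set u : ℕ → ℝ := fun N => g N / (N : ℝ) ^ a with hu
  -- almost monotonicity
  have hmono : ∀ δ : ℝ, 0 < δ → δ ≤ 1 → ∀ n : ℕ, 1 ≤ n → ∀ᶠ N : ℕ in atTop,
      u N ≤ u n + (C * (δ ^ a * (5 + 3 / (δ ^ 2 * n)) + 3 / (δ ^ 2 * n)) +
        A * (n : ℝ) ^ (1 / 2 - a)) := by
    intro δ hδ hδ1 n hn
    have hn0 : (0 : ℝ) < n := by exact_mod_cast hn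
    obtain ⟨Z, hZ⟩ := hscale ((1 + δ) / (1 + 2 * δ)) (by positivity)
      (by rw [div_lt_one (by positivity)]; linarith)
    filter_upwards [eventually_ge_atTop ⌈Z * ((1 + δ) * n)⌉₊, eventually_ge_atTop 1] with N hN hN1
    have hN0 : (0 : ℝ) < N := by exact_mod_cast hN1
    obtain ⟨k, hk, hk1, hk2, hb⟩ := hZ (N / ((1 + δ) * n)) (by
      rw [le_div_iff₀ (by positivity)]; exact Nat.ceil_le.1 hN)
    have hkd : 0 < k ^ d := by positivity
    have hl1 : (1 + δ) * n ≤ (k ^ d)⁻¹ * N := by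
      rw [le_div_iff₀ (by positivity)] at hk2
      rw [inv_mul_eq_div, le_div_iff₀ hkd]; linarith
    have hl2 : (k ^ d)⁻¹ * N ≤ (1 + 2 * δ) * n := by
      have e : (1 + δ) / (1 + 2 * δ) * (N / ((1 + δ) * n)) = N / ((1 + 2 * δ) * n) := by
        field_simp
      rw [e, div_le_iff₀ (by positivity)] at hk1
      rw [inv_mul_eq_div, div_le_iff₀ hkd]; linarith
    have hln : (n : ℝ) ≤ (k ^ d)⁻¹ * N := by nlinarith
    have h1 := hb.div_rpow_le hαβ hda hk (l := (k ^ d)⁻¹ * N) (N := N) (by positivity)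
      (by field_simp)
    have h2 := binMean_le_of_subadditive ha0.le (by linarith) hC g0 hgC hsub hδ hδ1 hn
      (inv_nonneg.2 hkd.le) (inv_le_one_of_one_le₀ (one_le_pow₀ hk)) hl1 hl2
    refine h1.trans ?_
    rw [← add_assoc]
    gcongr ?_ + ?_
    · have h3 : binMean (k ^ d)⁻¹ N g / ((k ^ d)⁻¹ * N) ^ a ≤
          (g n + C * (n : ℝ) ^ a * (δ ^ a * (5 + 3 / (δ ^ 2 * n)) + 3 / (δ ^ 2 * n))) /
            (n : ℝ) ^ a := by
        have := g0 n
        gcongr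
      refine h3.trans (le_of_eq ?_)
      simp only [hu]
      field_simp
    · gcongr A * ?_
      exact Real.rpow_le_rpow_of_nonpos hn0 hln (by linarith)
  have hu0 : ∀ N, 0 ≤ u N := fun N => div_nonneg (g0 N) (by positivity)
  have huC : ∀ N, u N ≤ C := fun N => div_le_of_le_mul₀ (by positivity) hC (hgC N)
  have hb1 : IsBoundedUnder (· ≤ ·) atTop u := isBoundedUnder_of ⟨C, huC⟩
  have hb2 : IsBoundedUnder (· ≥ ·) atTop u := isBoundedUnder_of ⟨0, hu0⟩
  -- comparison of the upper limit with individual terms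
  have hlim : ∀ δ : ℝ, 0 < δ → δ ≤ 1 → limsup u atTop ≤ liminf u atTop + C * (δ ^ a * 5) := by
    intro δ hδ hδ1
    set e : ℕ → ℝ := fun n => C * (δ ^ a * (5 + 3 / (δ ^ 2 * n)) + 3 / (δ ^ 2 * n)) +
        A * (n : ℝ) ^ (1 / 2 - a) with he
    have hn1 : Tendsto (fun n : ℕ => 3 / (δ ^ 2 * (n : ℝ))) atTop (𝓝 0) :=
      tendsto_const_nhds.div_atTop
        (tendsto_natCast_atTop_atTop.const_mul_atTop (by positivity))
    have hn2 : Tendsto (fun n : ℕ => (n : ℝ) ^ (1 / 2 - a)) atTop (𝓝 0) := by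
      have := (tendsto_rpow_neg_atTop (show 0 < a - 1 / 2 by linarith)).comp
        (tendsto_natCast_atTop_atTop (R := ℝ))
      simpa [Function.comp_def] using this
    have het : Tendsto e atTop (𝓝 (C * (δ ^ a * (5 + 0) + 0) + A * 0)) :=
      (((hn1.const_add 5).const_mul _).add hn1).const_mul C |>.add (hn2.const_mul A)
    simp only [add_zero, mul_zero] at het
    apply _root_.le_of_forall_pos_le_add
    intro ε hε
    have h1 : ∀ᶠ n in atTop, e n < C * (δ ^ a * 5) + ε / 2 :=
      het.eventually_lt_const (by linarith)
    have h2 : ∃ᶠ n in atTop, u n < liminf u atTop + ε / 2 :=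
      frequently_lt_of_liminf_lt hb1.isCoboundedUnder_ge (by linarith)
    obtain ⟨n, hn, ⟨hn', hn1⟩⟩ := (h2.and_eventually (h1.and (eventually_ge_atTop 1))).exists
    have h3 : limsup u atTop ≤ u n + e n :=
      limsup_le_of_le hb2.isCoboundedUnder_le (hmono δ hδ hδ1 n hn1)
    linarith
  have hlim' : limsup u atTop ≤ liminf u atTop := by
    have ht : Tendsto (fun δ : ℝ => liminf u atTop + C * (δ ^ a * 5)) (𝓝[>] 0)
        (𝓝 (liminf u atTop + C * ((0 : ℝ) ^ a * 5))) := by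
      apply Tendsto.mono_left _ nhdsWithin_le_nhds
      exact (((Real.continuousAt_rpow_const 0 a (Or.inr ha0.le)).tendsto.mul_const 5).const_mul
        C).const_add _
    rw [Real.zero_rpow ha0.ne', zero_mul, mul_zero, add_zero] at ht
    refine ge_of_tendsto ht ?_
    filter_upwards [Ioc_mem_nhdsGT (show (0 : ℝ) < 1 by norm_num)] with δ hδ
    exact hlim δ hδ.1 hδ.2
  exact ⟨limsup u atTop, tendsto_of_le_liminf_of_limsup_le hlim' le_rfl hb1 hb2⟩

/-- The uniform distribution on the unit cube. -/
noncomputable def unifBox (d : ℕ) : Measure (Fin d → ℝ) := volume.restrict (unitBox d)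

lemma measurableSet_unitBox (d : ℕ) : MeasurableSet (unitBox d) :=
  MeasurableSet.univ_pi fun _ => measurableSet_Ico

lemma unifBox_eq_pi (d : ℕ) :
    unifBox d = Measure.pi fun _ : Fin d => (volume : Measure ℝ).restrict (Set.Ico 0 1) :=
  Measure.restrict_pi_pi (fun _ : Fin d => (volume : Measure ℝ)) fun _ => Set.Ico 0 1

instance isProbabilityMeasure_restrict_Ico :
    IsProbabilityMeasure ((volume : Measure ℝ).restrict (Set.Ico 0 1)) :=
  ⟨by simp⟩

instance isProbabilityMeasure_unifBox (d : ℕ) : IsProbabilityMeasure (unifBox d) := by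
  rw [unifBox_eq_pi]; infer_instance

lemma ae_mem_unitBox (d : ℕ) : ∀ᵐ z ∂unifBox d, z ∈ unitBox d :=
  ae_restrict_mem (measurableSet_unitBox d)

lemma nnnorm_sub_le_one {d : ℕ} {z w : Fin d → ℝ} (hz : z ∈ unitBox d) (hw : w ∈ unitBox d) :
    ‖z - w‖₊ ≤ 1 := by
  rw [← NNReal.coe_le_coe, coe_nnnorm, NNReal.coe_one, pi_norm_le_iff_of_nonneg zero_le_one]
  intro i
  have h1 := hz i trivial
  have h2 := hw i trivial
  rw [Pi.sub_apply, Real.norm_eq_abs, abs_le]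
  constructor <;> linarith [h1.1, h1.2, h2.1, h2.2]

lemma rpow_nnnorm_sub_le_one {d : ℕ} {p : ℝ} (hp : 0 ≤ p) {z w : Fin d → ℝ}
    (hz : z ∈ unitBox d) (hw : w ∈ unitBox d) : (‖z - w‖₊ : ℝ≥0∞) ^ p ≤ 1 :=
  ENNReal.rpow_le_one (by exact_mod_cast nnnorm_sub_le_one hz hw) hp

lemma measurable_rpow_nnnorm_sub {d : ℕ} (p : ℝ) (w : Fin d → ℝ) :
    Measurable fun z : Fin d → ℝ => (‖z - w‖₊ : ℝ≥0∞) ^ p := by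
  fun_prop

/-- The ways of splitting the uniform distribution with total mass `card ι` into probability
measures indexed by `ι`. -/
def splittings (ι : Type) [Fintype ι] (d : ℕ) : Set (ι → Measure (Fin d → ℝ)) :=
  {ν | ∑ j, ν j = (Fintype.card ι : ℝ≥0∞) • unifBox d ∧ ∀ j, ν j Set.univ = 1}

/-- The cost of sending the `j`-th part `ν j` to the point `x j`, for all `j`. -/
noncomputable def splitCost {ι : Type} [Fintype ι] {d : ℕ} (p : ℝ) (x : ι → Fin d → ℝ)
    (ν : ι → Measure (Fin d → ℝ)) : ℝ≥0∞ :=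
  ∑ j, ∫⁻ z, (‖z - x j‖₊ : ℝ≥0∞) ^ p ∂ν j

/-- The optimal cost of transporting `card ι` times the uniform distribution to
`∑ j, δ_{x j}`. -/
noncomputable def matchCost {ι : Type} [Fintype ι] {d : ℕ} (p : ℝ) (x : ι → Fin d → ℝ) : ℝ≥0∞ :=
  ⨅ ν ∈ splittings ι d, splitCost p x ν

/-- The mean of `matchCost` for independent uniform points. -/
noncomputable def meanMatchCost (ι : Type) [Fintype ι] (d : ℕ) (p : ℝ) : ℝ≥0∞ :=
  ∫⁻ x, matchCost p x ∂Measure.pi fun _ : ι => unifBox d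

section splittings

variable {ι κ : Type} [Fintype ι] [Fintype κ] {d : ℕ} {p : ℝ}

lemma const_mem_splittings : (fun _ => unifBox d) ∈ splittings ι d := by
  refine ⟨?_, fun j => measure_univ⟩
  rw [Finset.sum_const, Finset.card_univ, Nat.cast_smul_eq_nsmul]

lemma ae_mem_unitBox_of_mem_splittings {ν : ι → Measure (Fin d → ℝ)} (hν : ν ∈ splittings ι d)
    (j : ι) : ∀ᵐ z ∂ν j, z ∈ unitBox d := by
  have h : ν j ≪ unifBox d := by
    have h1 : ν j ≤ ∑ j, ν j :=
      Finset.single_le_sum (fun i _ => Measure.zero_le (ν i)) (Finset.mem_univ j)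
    rw [hν.1] at h1
    exact h1.absolutelyContinuous.trans Measure.smul_absolutelyContinuous
  exact h.ae_le (ae_mem_unitBox d)

lemma splitCost_le_card (hp : 0 ≤ p) {x : ι → Fin d → ℝ} (hx : ∀ j, x j ∈ unitBox d)
    {ν : ι → Measure (Fin d → ℝ)} (hν : ν ∈ splittings ι d) :
    splitCost p x ν ≤ Fintype.card ι := by
  have h : ∀ j, ∫⁻ z, (‖z - x j‖₊ : ℝ≥0∞) ^ p ∂ν j ≤ 1 := by
    intro j
    calc ∫⁻ z, (‖z - x j‖₊ : ℝ≥0∞) ^ p ∂ν j ≤ ∫⁻ _, 1 ∂ν j := by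
          apply lintegral_mono_ae
          filter_upwards [ae_mem_unitBox_of_mem_splittings hν j] with z hz
          exact rpow_nnnorm_sub_le_one hp hz (hx j)
      _ = 1 := by rw [lintegral_one, hν.2 j]
  calc splitCost p x ν ≤ ∑ _j : ι, 1 := Finset.sum_le_sum fun j _ => h j
    _ = Fintype.card ι := by simp

lemma matchCost_le {x : ι → Fin d → ℝ} {ν : ι → Measure (Fin d → ℝ)} (hν : ν ∈ splittings ι d) :
    matchCost p x ≤ splitCost p x ν :=
  iInf₂_le ν hν

lemma matchCost_le_card (hp : 0 ≤ p) {x : ι → Fin d → ℝ} (hx : ∀ j, x j ∈ unitBox d) :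
    matchCost p x ≤ Fintype.card ι :=
  (matchCost_le const_mem_splittings).trans (splitCost_le_card hp hx const_mem_splittings)

lemma exists_seq_splitCost_tendsto (p : ℝ) (x : ι → Fin d → ℝ) :
    ∃ ν : ℕ → ι → Measure (Fin d → ℝ), (∀ n, ν n ∈ splittings ι d) ∧
      Filter.Tendsto (fun n => splitCost p x (ν n)) Filter.atTop (nhds (matchCost p x)) := by
  have hne : (splitCost p x '' splittings ι d).Nonempty := ⟨_, _, const_mem_splittings, rfl⟩
  obtain ⟨u, -, hu, hmem⟩ := exists_seq_tendsto_sInf hne (OrderBot.bddBelow _)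
  choose ν hν hνu using hmem
  refine ⟨ν, hν, ?_⟩
  rw [sInf_image] at hu
  simpa only [hνu, matchCost] using hu

lemma ae_pi_mem_unitBox (ι : Type) [Fintype ι] (d : ℕ) :
    ∀ᵐ x ∂Measure.pi fun _ : ι => unifBox d, ∀ j, x j ∈ unitBox d := by
  rw [ae_all_iff]
  intro j
  exact (measurePreserving_eval (fun _ : ι => unifBox d) j).quasiMeasurePreserving.ae
    (ae_mem_unitBox d)

lemma continuous_splitCost (hp : 0 ≤ p) {ν : ι → Measure (Fin d → ℝ)}
    (hν : ν ∈ splittings ι d) :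
    Continuous fun x : ι → Fin d → ℝ => splitCost p x ν := by
  refine continuous_finsetSum _ fun j _ => ?_
  have h : Continuous fun w : Fin d → ℝ => ∫⁻ z, (‖z - w‖₊ : ℝ≥0∞) ^ p ∂ν j := by
    rw [continuous_iff_continuousAt]
    intro w
    refine tendsto_lintegral_filter_of_dominated_convergence
      (fun _ => ((1 + (‖w‖₊ + 1) : NNReal) : ℝ≥0∞) ^ p)
      (Filter.Eventually.of_forall fun w => measurable_rpow_nnnorm_sub p w) ?_ ?_ ?_
    · filter_upwards [Metric.ball_mem_nhds w one_pos] with w' hw'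
      filter_upwards [ae_mem_unitBox_of_mem_splittings hν j] with z hz
      gcongr
      have h1 : ‖z‖₊ ≤ 1 := by
        have h0 : (0 : Fin d → ℝ) ∈ unitBox d := fun i _ => by simp
        simpa using nnnorm_sub_le_one hz h0
      have h2 : ‖w'‖₊ ≤ ‖w‖₊ + 1 := by
        have : ‖w' - w‖ < 1 := by simpa [dist_eq_norm] using hw'
        have h3 := norm_add_le w (w' - w)
        rw [add_sub_cancel] at h3
        rw [← NNReal.coe_le_coe]
        push_cast
        linarith
      exact (nnnorm_sub_le z w').trans (add_le_add h1 h2)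
    · rw [lintegral_const, hν.2 j, mul_one]
      exact ENNReal.rpow_ne_top_of_nonneg hp ENNReal.coe_ne_top
    · refine Filter.Eventually.of_forall fun z => Continuous.tendsto ?_ w
      exact ENNReal.continuous_rpow_const.comp (by fun_prop)
  exact h.comp (continuous_apply j)

lemma measurable_matchCost (hp : 0 ≤ p) :
    Measurable fun x : ι → Fin d → ℝ => matchCost p x :=
  (upperSemicontinuous_biInf fun _ hν =>
    (continuous_splitCost hp hν).upperSemicontinuous).measurable

lemma matchCost_sum_le (x : ι ⊕ κ → Fin d → ℝ) :
    matchCost p x ≤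
      matchCost p (fun i => x (Sum.inl i)) + matchCost p (fun i => x (Sum.inr i)) := by
  obtain ⟨ν, hν, hνt⟩ := exists_seq_splitCost_tendsto p fun i => x (Sum.inl i)
  obtain ⟨ν', hν', hνt'⟩ := exists_seq_splitCost_tendsto p fun i => x (Sum.inr i)
  refine ge_of_tendsto' (hνt.add hνt') fun n => ?_
  have hmem : Sum.elim (ν n) (ν' n) ∈ splittings (ι ⊕ κ) d := by
    refine ⟨?_, ?_⟩
    · rw [Fintype.sum_sum_type, Fintype.card_sum, Nat.cast_add, add_smul, ← (hν n).1, ← (hν' n).1]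
      rfl
    · rintro (j | j)
      · exact (hν n).2 j
      · exact (hν' n).2 j
  exact (matchCost_le hmem).trans_eq (by simp [splitCost])

lemma map_comp_pi (d : ℕ) (e : ι → κ) (he : Function.Injective e) :
    (Measure.pi fun _ : κ => unifBox d).map (fun x i => x (e i)) =
      Measure.pi fun _ : ι => unifBox d := by
  have h := (ProbabilityTheory.iIndepFun_pi (μ := fun _ : κ => unifBox d)
    (X := fun _ z => z) fun _ => aemeasurable_id).precomp he
  rw [ProbabilityTheory.iIndepFun_iff_map_fun_eq_pi_map
    fun i => (measurable_pi_apply (e i)).aemeasurable] at h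
  rw [h]
  congr with i : 1
  exact (measurePreserving_eval (fun _ : κ => unifBox d) (e i)).map_eq

lemma lintegral_matchCost_comp (hp : 0 ≤ p) (e : ι → κ) (he : Function.Injective e) :
    ∫⁻ x, matchCost p (fun i => x (e i)) ∂(Measure.pi fun _ : κ => unifBox d) =
      meanMatchCost ι d p := by
  rw [meanMatchCost, ← map_comp_pi d e he, lintegral_map (measurable_matchCost hp) (by fun_prop)]

lemma meanMatchCost_le_card (hp : 0 ≤ p) : meanMatchCost ι d p ≤ Fintype.card ι := by
  calc meanMatchCost ι d p ≤ ∫⁻ _, Fintype.card ι ∂Measure.pi fun _ : ι => unifBox d := by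
        apply lintegral_mono_ae
        filter_upwards [ae_pi_mem_unitBox ι d] with x hx
        exact matchCost_le_card hp hx
    _ = Fintype.card ι := by simp

lemma meanMatchCost_sum_le (hp : 0 ≤ p) :
    meanMatchCost (ι ⊕ κ) d p ≤ meanMatchCost ι d p + meanMatchCost κ d p := by
  have hm : Measurable fun x : ι ⊕ κ → Fin d → ℝ => matchCost p fun i => x (Sum.inl i) :=
    (measurable_matchCost hp).comp (measurable_pi_lambda _ fun i => measurable_pi_apply _)
  rw [← lintegral_matchCost_comp hp (Sum.inl : ι → ι ⊕ κ) Sum.inl_injective,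
    ← lintegral_matchCost_comp hp (Sum.inr : κ → ι ⊕ κ) Sum.inr_injective,
    ← lintegral_add_left hm]
  exact lintegral_mono fun x => matchCost_sum_le x

lemma matchCost_comp_equiv (e : ι ≃ κ) (x : κ → Fin d → ℝ) :
    matchCost p (fun i => x (e i)) ≤ matchCost p x := by
  refine le_iInf₂ fun ν hν => ?_
  have hmem : (fun i => ν (e i)) ∈ splittings ι d :=
    ⟨by rw [Equiv.sum_comp e ν, hν.1, Fintype.card_congr e], fun j => hν.2 _⟩
  exact (matchCost_le hmem).trans_eq <|
    Equiv.sum_comp e fun j => ∫⁻ z, (‖z - x j‖₊ : ℝ≥0∞) ^ p ∂ν j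

lemma meanMatchCost_le_of_equiv (hp : 0 ≤ p) (e : ι ≃ κ) :
    meanMatchCost ι d p ≤ meanMatchCost κ d p := by
  rw [← lintegral_matchCost_comp hp e e.injective]
  exact lintegral_mono fun x => matchCost_comp_equiv e x

lemma meanMatchCost_congr (hp : 0 ≤ p) (e : ι ≃ κ) : meanMatchCost ι d p = meanMatchCost κ d p :=
  (meanMatchCost_le_of_equiv hp e).antisymm (meanMatchCost_le_of_equiv hp e.symm)

end splittings

section subdivision

variable {ι : Type} [Fintype ι] {d : ℕ} {p : ℝ}

lemma pi_eq_smul_sum_map [DecidableEq ι] {I α : Type} [Fintype I] [MeasurableSpace α]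
    {μ : Measure α} [IsProbabilityMeasure μ] {φ : I → α → α} (hφ : ∀ i, Measurable (φ i)) {c : ℝ≥0∞}
    (h : μ = c • ∑ i, μ.map (φ i)) :
    (Measure.pi fun _ : ι => μ) = c ^ Fintype.card ι •
      ∑ σ : ι → I, (Measure.pi fun _ : ι => μ).map fun y j => φ (σ j) (y j) := by
  refine Measure.pi_eq fun s hs => ?_
  have h1 : ∀ j, μ (s j) = c * ∑ i, μ (φ i ⁻¹' s j) := by
    intro j
    conv_lhs => rw [h]
    rw [Measure.smul_apply, Measure.finsetSum_apply, smul_eq_mul]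
    congr 1
    exact Finset.sum_congr rfl fun i _ => Measure.map_apply (hφ i) (hs j)
  rw [Measure.smul_apply, Measure.finsetSum_apply, smul_eq_mul,
    Finset.prod_congr rfl fun j _ => h1 j, Finset.prod_mul_distrib, Finset.prod_const, Finset.card_univ, Finset.prod_univ_sum,
    Fintype.piFinset_univ]
  congr 1
  refine Finset.sum_congr rfl fun σ _ => ?_
  have hm : Measurable fun (y : ι → α) j => φ (σ j) (y j) :=
    measurable_pi_lambda _ fun j => (hφ _).comp (measurable_pi_apply j)
  rw [Measure.map_apply hm (MeasurableSet.univ_pi hs), ← Measure.pi_pi]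
  congr 1

lemma restrict_Ico_eq_smul_sum_map {k : ℕ} (hk : 1 ≤ k) :
    (volume : Measure ℝ).restrict (Set.Ico 0 1) = (k : ℝ≥0∞)⁻¹ •
      ∑ i : Fin k, ((volume : Measure ℝ).restrict (Set.Ico 0 1)).map
        fun t => ((i : ℝ) + t) / k := by
  have hk0 : (0 : ℝ) < k := by exact_mod_cast hk
  have hk0' : (k : ℝ≥0∞) ≠ 0 := by simp; omega
  have h1 : ∀ i : Fin k, ((volume : Measure ℝ).restrict (Set.Ico 0 1)).map
      (fun t => ((i : ℝ) + t) / k) =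
        (k : ℝ≥0∞) • (volume : Measure ℝ).restrict (Set.Ico ((i : ℝ) / k) (((i : ℝ) + 1) / k)) := by
    intro i
    have e1 : (volume : Measure ℝ).map (fun t => ((i : ℝ) + t) / k) = (k : ℝ≥0∞) • volume := by
      have e : (fun t : ℝ => ((i : ℝ) + t) / k) =
          (fun t => (k : ℝ)⁻¹ * t) ∘ fun t => (i : ℝ) + t := by
        funext t; simp [div_eq_inv_mul]
      rw [e, ← Measure.map_map (by fun_prop) (by fun_prop), map_add_left_eq_self,
        Real.map_volume_mul_left (by positivity), inv_inv, abs_of_pos hk0, ENNReal.ofReal_natCast]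
    have e2 : Set.Ico (0 : ℝ) 1 = (fun t => ((i : ℝ) + t) / k) ⁻¹'
        Set.Ico ((i : ℝ) / k) (((i : ℝ) + 1) / k) := by
      ext t
      simp only [Set.mem_Ico, Set.mem_preimage]
      rw [div_le_div_iff_of_pos_right hk0, div_lt_div_iff_of_pos_right hk0]
      constructor <;> rintro ⟨h, h'⟩ <;> constructor <;> linarith
    rw [e2, ← Measure.restrict_map (by fun_prop) measurableSet_Ico, e1, Measure.restrict_smul]
  rw [Finset.sum_congr rfl fun i _ => h1 i, ← Finset.smul_sum, smul_smul,
    ENNReal.inv_mul_cancel hk0' (ENNReal.natCast_ne_top k), one_smul, ← Measure.sum_fintype,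
    ← Measure.restrict_iUnion _ fun i => measurableSet_Ico]
  · congr 1
    ext t
    simp only [Set.mem_Ico, Set.mem_iUnion]
    constructor
    · rintro ⟨h, h'⟩
      refine ⟨⟨⌊t * k⌋₊, ?_⟩, ?_, ?_⟩
      · rw [Nat.floor_lt (by positivity)]
        nlinarith
      · rw [div_le_iff₀ hk0]
        exact Nat.floor_le (by positivity)
      · rw [lt_div_iff₀ hk0]
        exact Nat.lt_floor_add_one _
    · rintro ⟨i, h, h'⟩
      refine ⟨le_trans (by positivity) h, h'.trans_le ?_⟩
      rw [div_le_one hk0]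
      exact_mod_cast i.2
  · intro i j hij
    rw [Function.onFun, Set.disjoint_left]
    rintro t ⟨h1, h2⟩ ⟨h3, h4⟩
    rw [div_le_iff₀ hk0] at h1 h3
    rw [lt_div_iff₀ hk0] at h2 h4
    have e1 : ((i : ℕ) : ℝ) < ((j : ℕ) : ℝ) + 1 := by linarith
    have e2 : ((j : ℕ) : ℝ) < ((i : ℕ) : ℝ) + 1 := by linarith
    norm_cast at e1 e2
    exact hij (Fin.ext (by omega))

/-- The similarity mapping the unit cube to the `i`-th cell of its subdivision into
`k ^ d` cells. -/
noncomputable def cellMap {d k : ℕ} (i : Fin d → Fin k) (z : Fin d → ℝ) : Fin d → ℝ :=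
  fun c => (((i c : ℕ) : ℝ) + z c) / k

lemma measurable_cellMap {k : ℕ} (i : Fin d → Fin k) : Measurable (cellMap i) := by
  unfold cellMap; fun_prop

lemma unifBox_eq_smul_sum_map {k : ℕ} (hk : 1 ≤ k) :
    unifBox d = ((k : ℝ≥0∞)⁻¹) ^ d • ∑ i : Fin d → Fin k, (unifBox d).map (cellMap i) := by
  have := pi_eq_smul_sum_map (ι := Fin d) (fun i : Fin k => by fun_prop)
    (restrict_Ico_eq_smul_sum_map hk)
  rw [← unifBox_eq_pi, Fintype.card_fin] at this
  exact this

lemma cellMap_mem_unitBox {k : ℕ} (hk : 1 ≤ k) (i : Fin d → Fin k) {z : Fin d → ℝ}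
    (hz : z ∈ unitBox d) : cellMap i z ∈ unitBox d := by
  intro c _
  have hk0 : (0 : ℝ) < k := by exact_mod_cast hk
  have h := hz c trivial
  have h1 : 0 ≤ z c := h.1
  refine ⟨by unfold cellMap; positivity, ?_⟩
  have h2 : ((i c : ℕ) : ℝ) + 1 ≤ k := by exact_mod_cast (i c).2
  rw [cellMap, div_lt_one hk0]
  linarith [h.2]

lemma nnnorm_cellMap_sub {k : ℕ} (i : Fin d → Fin k) (z w : Fin d → ℝ) :
    ‖cellMap i z - cellMap i w‖₊ = (k : NNReal)⁻¹ * ‖z - w‖₊ := by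
  have e : cellMap i z - cellMap i w = (k : ℝ)⁻¹ • (z - w) := by
    funext c
    simp [cellMap]
    ring
  rw [e, nnnorm_smul]
  simp

lemma matchCost_cellMap_le (hp : 0 ≤ p) {k : ℕ} (hk : 1 ≤ k) (σ : ι → Fin d → Fin k)
    {y : ι → Fin d → ℝ} (hy : ∀ j, y j ∈ unitBox d) :
    matchCost p (fun j => cellMap (σ j) (y j)) ≤
      ∑ i, ((k : ℝ≥0∞)⁻¹) ^ p * matchCost p (fun j : {j // σ j = i} => y j) +
      ∑ i, ((Fintype.card {j // σ j = i} : ℝ≥0∞) -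
        Fintype.card ι * ((k : ℝ≥0∞)⁻¹) ^ d) := by
  have hk0' : (k : ℝ≥0∞) ≠ 0 := by simp; omega
  have hkt : (k : ℝ≥0∞)⁻¹ ≠ ⊤ := by simp; omega
  choose ν hν hνt using fun i => exists_seq_splitCost_tendsto p (fun j : {j // σ j = i} => y j)
  have ht := (tendsto_finsetSum Finset.univ fun i _ => ENNReal.Tendsto.const_mul (hνt i)
    (Or.inr (ENNReal.rpow_ne_top_of_nonneg hp hkt))).add_const
      (∑ i, ((Fintype.card {j // σ j = i} : ℝ≥0∞) - Fintype.card ι * ((k : ℝ≥0∞)⁻¹) ^ d))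
  refine ge_of_tendsto' ht fun s => ?_
  clear ht hνt
  replace hν := fun i => hν i s
  set t : ℝ≥0∞ := Fintype.card ι * ((k : ℝ≥0∞)⁻¹) ^ d with htdef
  set n : (Fin d → Fin k) → ℝ≥0∞ := fun i => Fintype.card {j // σ j = i} with hn
  have htt : t ≠ ⊤ := ENNReal.mul_ne_top (ENNReal.natCast_ne_top _) (ENNReal.pow_ne_top hkt)
  have hnt : ∀ i, n i ≠ ⊤ := fun i => ENNReal.natCast_ne_top _
  set θ : (Fin d → Fin k) → ℝ≥0∞ := fun i => min 1 (t / n i)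
  have hθ1 : ∀ i, θ i ≤ 1 := fun i => min_le_left _ _
  have hθn : ∀ i, θ i * n i = min (n i) t := by
    intro i
    by_cases h : n i = 0
    · simp [h]
    · simp only [θ]
      rw [min_mul_of_nonneg _ _ zero_le, one_mul, ENNReal.div_mul_cancel h (hnt i)]
  have hrn : ∀ i, (1 - θ i) * n i = n i - t := by
    intro i
    rw [ENNReal.sub_mul fun _ _ => hnt i, one_mul, hθn, tsub_min]
  set ρ : ℝ≥0∞ := ∑ i, (t - n i) with hρ
  set rest : Measure (Fin d → ℝ) := ∑ i, (t - n i) • (unifBox d).map (cellMap i) with hrest_def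
  have hmapprob : ∀ i : Fin d → Fin k, IsProbabilityMeasure ((unifBox d).map (cellMap i)) :=
    fun i => Measure.isProbabilityMeasure_map (measurable_cellMap i).aemeasurable
  have hrest : rest Set.univ = ρ := by
    simp [hrest_def, hρ, Measure.finsetSum_apply]
  have hρt : ρ ≠ ⊤ := by
    rw [hρ]
    exact ENNReal.sum_ne_top.2 fun i _ => ne_top_of_le_ne_top htt tsub_le_self
  have hnsum : ∑ i, n i = Fintype.card ι := by
    simp only [hn]
    rw [← Nat.cast_sum, ← Fintype.card_sigma, Fintype.card_congr (Equiv.sigmaFiberEquiv σ)]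
  have hkd : ((k : ℝ≥0∞)⁻¹) ^ d * (k : ℝ≥0∞) ^ d = 1 := by
    rw [← mul_pow, ENNReal.inv_mul_cancel hk0' (ENNReal.natCast_ne_top k), one_pow]
  have htsum : ∑ _i : Fin d → Fin k, t = Fintype.card ι := by
    rw [Finset.sum_const, Finset.card_univ, Fintype.card_fun, Fintype.card_fin, Fintype.card_fin,
      nsmul_eq_mul, htdef, mul_comm, mul_assoc, Nat.cast_pow, hkd, mul_one]
  have hρ' : ∑ i, (n i - t) = ρ := by
    have e1 : ∑ i, min (n i) t + ∑ i, (n i - t) = Fintype.card ι := by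
      rw [← Finset.sum_add_distrib, ← hnsum]
      refine Finset.sum_congr rfl fun i _ => ?_
      rcases le_total (n i) t with h | h
      · rw [min_eq_left h, tsub_eq_zero_of_le h, add_zero]
      · rw [min_eq_right h, add_tsub_cancel_of_le h]
    have e2 : ∑ i, min (n i) t + ρ = Fintype.card ι := by
      rw [hρ, ← Finset.sum_add_distrib, ← htsum]
      refine Finset.sum_congr rfl fun i _ => ?_
      rcases le_total (n i) t with h | h
      · rw [min_eq_left h, add_tsub_cancel_of_le h]
      · rw [min_eq_right h, tsub_eq_zero_of_le h, add_zero]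
    have e3 : ∑ i, min (n i) t ≠ ⊤ :=
      ENNReal.sum_ne_top.2 fun i _ => ne_top_of_le_ne_top htt (min_le_right _ _)
    exact (ENNReal.add_right_inj e3).1 (e1.trans e2.symm)
  have hrsum : ∑ j, (1 - θ (σ j)) = ρ := by
    rw [← hρ', ← Fintype.sum_fiberwise σ]
    refine Finset.sum_congr rfl fun i _ => ?_
    rw [← hrn, Finset.sum_congr rfl (g := fun _ => 1 - θ i) fun j _ => by rw [j.2],
      Finset.sum_const, Finset.card_univ, nsmul_eq_mul, mul_comm]
  have hr : ∀ j, (1 - θ (σ j)) / ρ * ρ = 1 - θ (σ j) := by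
    intro j
    by_cases h : ρ = 0
    · rw [h, mul_zero]
      rw [h, Finset.sum_eq_zero_iff] at hrsum
      exact (hrsum j (Finset.mem_univ j)).symm
    · exact ENNReal.div_mul_cancel h hρt
  set ν' : ι → Measure (Fin d → ℝ) := fun j => (ν (σ j) s ⟨j, rfl⟩).map (cellMap (σ j)) with hν'
  set μ : ι → Measure (Fin d → ℝ) := fun j => θ (σ j) • ν' j + ((1 - θ (σ j)) / ρ) • rest with hμ
  have hν'u : ∀ j, ν' j Set.univ = 1 := by
    intro j
    simp only [hν']
    rw [Measure.map_apply (measurable_cellMap _) MeasurableSet.univ, Set.preimage_univ]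
    exact (hν _).2 _
  have hμmem : μ ∈ splittings ι d := by
    refine ⟨?_, fun j => ?_⟩
    · have e1 : ∑ j, θ (σ j) • ν' j = ∑ i, min (n i) t • (unifBox d).map (cellMap i) := by
        rw [← Fintype.sum_fiberwise σ]
        refine Finset.sum_congr rfl fun i _ => ?_
        have : ∀ j : {j // σ j = i}, θ (σ j) • ν' j = θ i • (ν i s j).map (cellMap i) := by
          rintro ⟨j, rfl⟩; rfl
        rw [Finset.sum_congr rfl fun j _ => this j, ← Finset.smul_sum,
          ← Measure.map_finset_sum' (measurable_cellMap i).aemeasurable, (hν i).1,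
          Measure.map_smul, smul_smul, ← hθn]
      have e2 : ∑ j, ((1 - θ (σ j)) / ρ) • rest = rest := by
        by_cases h : ρ = 0
        · have : rest = 0 := Measure.measure_univ_eq_zero.1 (hrest.trans h)
          simp [this]
        · simp only [div_eq_mul_inv]
          rw [← Finset.sum_smul, ← Finset.sum_mul, hrsum, ENNReal.mul_inv_cancel h hρt, one_smul]
      simp only [hμ]
      rw [Finset.sum_add_distrib, e1, e2, hrest_def, ← Finset.sum_add_distrib]
      conv_rhs => rw [unifBox_eq_smul_sum_map (d := d) hk, smul_smul, ← htdef, Finset.smul_sum]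
      refine Finset.sum_congr rfl fun i _ => ?_
      rw [← add_smul]
      congr 1
      rcases le_total (n i) t with h | h
      · rw [min_eq_left h, add_tsub_cancel_of_le h]
      · rw [min_eq_right h, tsub_eq_zero_of_le h, add_zero]
    · simp only [hμ, Measure.add_apply, Measure.smul_apply, smul_eq_mul]
      rw [hν'u, hrest, hr, mul_one, add_tsub_cancel_of_le (hθ1 _)]
  refine (matchCost_le hμmem).trans ?_
  have hbox : ∀ᵐ z ∂rest, z ∈ unitBox d := by
    rw [ae_iff, hrest_def, Measure.finsetSum_apply]
    refine Finset.sum_eq_zero fun i _ => ?_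
    have hms : MeasurableSet {z | z ∉ unitBox d} := (measurableSet_unitBox d).compl
    rw [Measure.smul_apply, Measure.map_apply (measurable_cellMap i) hms, smul_eq_mul]
    have : unifBox d (cellMap i ⁻¹' {z | z ∉ unitBox d}) = 0 := by
      have := ae_mem_unitBox d
      rw [ae_iff] at this
      exact measure_mono_null (fun z hz hz' => hz (cellMap_mem_unitBox hk i hz')) this
    exact mul_eq_zero_of_right _ this
  have hcost : ∀ j, ∫⁻ z, (‖z - cellMap (σ j) (y j)‖₊ : ℝ≥0∞) ^ p ∂μ j ≤
      ((k : ℝ≥0∞)⁻¹) ^ p * ∫⁻ z, (‖z - y j‖₊ : ℝ≥0∞) ^ p ∂ν (σ j) s ⟨j, rfl⟩ + (1 - θ (σ j)) := by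
    intro j
    simp only [hμ]
    rw [lintegral_add_measure, lintegral_smul_measure, lintegral_smul_measure]
    gcongr ?_ + ?_
    · refine (mul_le_of_le_one_left zero_le (hθ1 _)).trans ?_
      simp only [hν']
      rw [lintegral_map (measurable_rpow_nnnorm_sub p _) (measurable_cellMap _),
        ← lintegral_const_mul _ (measurable_rpow_nnnorm_sub p _)]
      refine lintegral_mono fun z => le_of_eq ?_
      rw [nnnorm_cellMap_sub, ENNReal.coe_mul, ENNReal.mul_rpow_of_nonneg _ _ hp,
        ENNReal.coe_inv (by simp; omega), ENNReal.coe_natCast]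
    · calc ((1 - θ (σ j)) / ρ) • ∫⁻ z, (‖z - cellMap (σ j) (y j)‖₊ : ℝ≥0∞) ^ p ∂rest
          ≤ (1 - θ (σ j)) / ρ * ∫⁻ _, 1 ∂rest := by
            rw [smul_eq_mul]
            refine mul_le_mul_right ?_ _
            apply lintegral_mono_ae
            filter_upwards [hbox] with z hz
            exact rpow_nnnorm_sub_le_one hp hz (cellMap_mem_unitBox hk _ (hy j))
        _ = 1 - θ (σ j) := by rw [lintegral_one, hrest, hr]
  refine (Finset.sum_le_sum fun j _ => hcost j).trans ?_
  rw [Finset.sum_add_distrib, hrsum, hρ']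
  gcongr ?_ + _
  rw [← Fintype.sum_fiberwise σ]
  refine le_of_eq (Finset.sum_congr rfl fun i _ => ?_)
  rw [splitCost, Finset.mul_sum]
  refine Finset.sum_congr rfl fun j _ => ?_
  obtain ⟨j, rfl⟩ := j
  rfl

end subdivision

section recursion

lemma sum_fiber_card_eq_binMean {I : Type} [Fintype I] [DecidableEq I] (i : I) (N : ℕ)
    (h : ℕ → ℝ) :
    ∑ σ : Fin N → I, h (Fintype.card {j // σ j = i}) =
      (Fintype.card I : ℝ) ^ N * binMean (Fintype.card I : ℝ)⁻¹ N h := by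
  have : Nonempty I := ⟨i⟩
  have hI : (Fintype.card I : ℝ) ≠ 0 := by exact_mod_cast Fintype.card_ne_zero
  have hcard : ∀ (M : ℕ) (σ : Fin M → I),
      Fintype.card {j // σ j = i} = ∑ j, if σ j = i then 1 else 0 := fun M σ => by
    rw [Fintype.card_subtype, Finset.card_filter]
  induction N generalizing h with
  | zero => simp [binMean]
  | succ N ih =>
    have e1 : ∀ a : I, ∑ σ : Fin N → I,
        h (∑ j, if Fin.cons (α := fun _ => I) a σ j = i then 1 else 0) =
        if a = i then
          (Fintype.card I : ℝ) ^ N * binMean (Fintype.card I : ℝ)⁻¹ N (fun n => h (n + 1))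
        else (Fintype.card I : ℝ) ^ N * binMean (Fintype.card I : ℝ)⁻¹ N h := by
      intro a
      simp only [Fin.sum_univ_succ, Fin.cons_zero, Fin.cons_succ]
      split_ifs with ha
      · rw [← ih]
        simp only [hcard, add_comm]
      · rw [← ih]
        simp only [hcard, zero_add]
    simp only [hcard]
    rw [← (Fin.consEquiv fun _ => I).sum_comp, Fintype.sum_prod_type]
    simp only [Fin.consEquiv_apply]
    rw [Finset.sum_congr rfl fun a _ => e1 a, Finset.sum_ite, Finset.sum_const, Finset.sum_const,
      Finset.filter_eq', if_pos (Finset.mem_univ i), Finset.card_singleton, Finset.filter_ne',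
      Finset.card_erase_of_mem (Finset.mem_univ i), Finset.card_univ, nsmul_eq_mul, nsmul_eq_mul,
      Nat.cast_sub Fintype.card_pos]
    simp only [binMean]
    field_simp
    push_cast
    ring

variable {ι : Type} [Fintype ι] {d : ℕ} {p : ℝ}

lemma meanMatchCost_le_sum [DecidableEq ι] (hp : 0 ≤ p) {k : ℕ} (hk : 1 ≤ k) :
    meanMatchCost ι d p ≤ (((k : ℝ≥0∞)⁻¹) ^ d) ^ Fintype.card ι *
      ∑ σ : ι → Fin d → Fin k,
        (∑ i, ((k : ℝ≥0∞)⁻¹) ^ p * meanMatchCost {j // σ j = i} d p +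
          ∑ i, ((Fintype.card {j // σ j = i} : ℝ≥0∞) -
            Fintype.card ι * ((k : ℝ≥0∞)⁻¹) ^ d)) := by
  have hcell : ∀ σ : ι → Fin d → Fin k,
      Measurable fun (y : ι → Fin d → ℝ) j => cellMap (σ j) (y j) := fun σ =>
    measurable_pi_lambda _ fun j => (measurable_cellMap _).comp (measurable_pi_apply j)
  have hsub : ∀ (σ : ι → Fin d → Fin k) (i : Fin d → Fin k),
      Measurable fun y : ι → Fin d → ℝ => matchCost p (fun j : {j // σ j = i} => y j) :=
    fun σ i => (measurable_matchCost hp).comp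
      (measurable_pi_lambda _ fun j => measurable_pi_apply _)
  rw [meanMatchCost, pi_eq_smul_sum_map measurable_cellMap (unifBox_eq_smul_sum_map (d := d) hk),
    lintegral_smul_measure, smul_eq_mul, lintegral_finsetSum_measure]
  refine mul_le_mul_right (Finset.sum_le_sum fun σ _ => ?_) _
  rw [lintegral_map (measurable_matchCost hp) (hcell σ)]
  calc ∫⁻ y, matchCost p (fun j => cellMap (σ j) (y j)) ∂(Measure.pi fun _ : ι => unifBox d)
      ≤ ∫⁻ y, (∑ i, ((k : ℝ≥0∞)⁻¹) ^ p * matchCost p (fun j : {j // σ j = i} => y j) +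
          ∑ i, ((Fintype.card {j // σ j = i} : ℝ≥0∞) - Fintype.card ι * ((k : ℝ≥0∞)⁻¹) ^ d))
          ∂(Measure.pi fun _ : ι => unifBox d) := by
        apply lintegral_mono_ae
        filter_upwards [ae_pi_mem_unitBox ι d] with y hy
        exact matchCost_cellMap_le hp hk σ hy
    _ = _ := by
        rw [lintegral_add_right _ measurable_const, lintegral_const, measure_univ, mul_one,
          lintegral_finsetSum _ fun i _ => (hsub σ i).const_mul _]
        congr 1
        refine Finset.sum_congr rfl fun i _ => ?_
        rw [lintegral_const_mul _ (hsub σ i),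
          lintegral_matchCost_comp hp _ Subtype.val_injective]

/-- The mean matching cost of `n` independent uniform points, as a real number. -/
noncomputable def realMeanCost (d : ℕ) (p : ℝ) (n : ℕ) : ℝ := (meanMatchCost (Fin n) d p).toReal

lemma meanMatchCost_eq_ofReal (hp : 0 ≤ p) :
    meanMatchCost ι d p = ENNReal.ofReal (realMeanCost d p (Fintype.card ι)) := by
  rw [realMeanCost, ← meanMatchCost_congr hp (Fintype.equivFin ι), ENNReal.ofReal_toReal]
  exact ne_top_of_le_ne_top (ENNReal.natCast_ne_top _) (meanMatchCost_le_card hp)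

lemma realMeanCost_nonneg (n : ℕ) : 0 ≤ realMeanCost d p n := ENNReal.toReal_nonneg

lemma realMeanCost_le (hp : 0 ≤ p) (n : ℕ) : realMeanCost d p n ≤ n := by
  have h := meanMatchCost_le_card (ι := Fin n) (d := d) hp
  rw [Fintype.card_fin] at h
  exact ENNReal.toReal_le_of_le_ofReal (by positivity) (by simpa using h)

lemma realMeanCost_add_le (hp : 0 ≤ p) (m n : ℕ) :
    realMeanCost d p (m + n) ≤ realMeanCost d p m + realMeanCost d p n := by
  have h := meanMatchCost_sum_le (ι := Fin m) (κ := Fin n) (d := d) hp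
  rw [meanMatchCost_eq_ofReal hp, meanMatchCost_eq_ofReal hp, meanMatchCost_eq_ofReal hp,
    ← ENNReal.ofReal_add (realMeanCost_nonneg _) (realMeanCost_nonneg _),
    ENNReal.ofReal_le_ofReal_iff (add_nonneg (realMeanCost_nonneg _) (realMeanCost_nonneg _))] at h
  simpa using h

lemma realMeanCost_le_sum (hp : 0 ≤ p) {k : ℕ} (hk : 1 ≤ k) (N : ℕ) :
    realMeanCost d p N ≤ (((k : ℝ)⁻¹) ^ d) ^ N * ∑ σ : Fin N → Fin d → Fin k,
      (∑ i, ((k : ℝ)⁻¹) ^ p * realMeanCost d p (Fintype.card {j // σ j = i}) +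
        ∑ i, |(Fintype.card {j // σ j = i} : ℝ) - ((k : ℝ)⁻¹) ^ d * N|) := by
  have hk0 : (0 : ℝ) < k := by exact_mod_cast hk
  have hq : (k : ℝ≥0∞)⁻¹ = ENNReal.ofReal (k : ℝ)⁻¹ := by
    rw [ENNReal.ofReal_inv_of_pos hk0, ENNReal.ofReal_natCast]
  have h := meanMatchCost_le_sum (ι := Fin N) (d := d) hp hk
  have hg : ∀ n, 0 ≤ realMeanCost d p n := realMeanCost_nonneg
  have hq0 : 0 ≤ (k : ℝ)⁻¹ := by positivity
  have ht : ∀ (σ : Fin N → Fin d → Fin k) (i : Fin d → Fin k),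
      0 ≤ ((k : ℝ)⁻¹) ^ p * realMeanCost d p (Fintype.card {j // σ j = i}) := fun σ i =>
    mul_nonneg (Real.rpow_nonneg hq0 p) (hg _)
  have ht' : ∀ σ : Fin N → Fin d → Fin k,
      0 ≤ ∑ i, ((k : ℝ)⁻¹) ^ p * realMeanCost d p (Fintype.card {j // σ j = i}) := fun σ =>
    Finset.sum_nonneg fun i _ => ht σ i
  have hs : ∀ σ : Fin N → Fin d → Fin k,
      0 ≤ ∑ i, ((k : ℝ)⁻¹) ^ p * realMeanCost d p (Fintype.card {j // σ j = i}) +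
        ∑ i, |(Fintype.card {j // σ j = i} : ℝ) - ((k : ℝ)⁻¹) ^ d * N| := fun σ =>
    add_nonneg (ht' σ) (Finset.sum_nonneg fun i _ => abs_nonneg _)
  rw [← ENNReal.ofReal_le_ofReal_iff (mul_nonneg (by positivity)
      (Finset.sum_nonneg fun σ _ => hs σ)), ENNReal.ofReal_mul (by positivity),
    ENNReal.ofReal_sum_of_nonneg fun σ _ => hs σ]
  rw [meanMatchCost_eq_ofReal hp, Fintype.card_fin, hq] at h
  refine h.trans ?_
  rw [ENNReal.ofReal_pow (by positivity), ENNReal.ofReal_pow hq0]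
  refine mul_le_mul_right (Finset.sum_le_sum fun σ _ => ?_) _
  rw [ENNReal.ofReal_add (ht' σ) (by positivity), ENNReal.ofReal_sum_of_nonneg fun i _ => ht σ i,
    ENNReal.ofReal_sum_of_nonneg fun i _ => abs_nonneg _]
  gcongr with i _ i _
  · rw [ENNReal.ofReal_mul (by positivity), ENNReal.ofReal_rpow_of_nonneg hq0 hp,
      meanMatchCost_eq_ofReal hp]
  · rw [← ENNReal.ofReal_pow hq0, ← ENNReal.ofReal_natCast (Fintype.card _),
      ← ENNReal.ofReal_natCast N, ← ENNReal.ofReal_mul (by positivity),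
      ← ENNReal.ofReal_sub _ (by positivity), mul_comm]
    exact ENNReal.ofReal_le_ofReal (le_abs_self _)

lemma binBound_realMeanCost (hp : 0 ≤ p) {k : ℕ} (hk : 1 ≤ k) :
    BinBound (realMeanCost d p) ((k : ℝ) ^ (d - p)) ((k : ℝ) ^ d)⁻¹ √((k : ℝ) ^ d) := by
  intro N
  have hk0 : (0 : ℝ) < k := by exact_mod_cast hk
  have hkd : (0 : ℝ) < (k : ℝ) ^ d := by positivity
  have hq1 : ((k : ℝ) ^ d)⁻¹ ≤ 1 := inv_le_one_of_one_le₀ (one_le_pow₀ (by exact_mod_cast hk))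
  have hcard : (Fintype.card (Fin d → Fin k) : ℝ) = (k : ℝ) ^ d := by simp
  refine (realMeanCost_le_sum hp hk N).trans ?_
  rw [Finset.sum_add_distrib, Finset.sum_comm, Finset.sum_comm (f := fun σ i => |_|)]
  have hdev : ∀ i : Fin d → Fin k, ∑ σ : Fin N → Fin d → Fin k,
      |(Fintype.card {j // σ j = i} : ℝ) - ((k : ℝ)⁻¹) ^ d * N| =
        ((k : ℝ) ^ d) ^ N * binMean ((k : ℝ) ^ d)⁻¹ N fun n => |(n : ℝ) - ((k : ℝ)⁻¹) ^ d * N| :=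
    fun i => by
      rw [← hcard]
      exact sum_fiber_card_eq_binMean i N fun n => |(n : ℝ) - ((k : ℝ)⁻¹) ^ d * N|
  simp only [← Finset.mul_sum]
  simp only [sum_fiber_card_eq_binMean (h := realMeanCost d p), hdev, hcard,
    Finset.sum_const, Finset.card_univ, nsmul_eq_mul]
  simp only [inv_pow]
  have h1 := binMean.abs_sub_le (inv_nonneg.2 hkd.le) hq1 N
  have h2 : (k : ℝ) ^ (d - p) = (k : ℝ) ^ d * ((k : ℝ)⁻¹) ^ p := by
    rw [Real.rpow_sub hk0, Real.rpow_natCast, Real.inv_rpow hk0.le, div_eq_mul_inv]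
  have h3 : (k : ℝ) ^ d * √(((k : ℝ) ^ d)⁻¹ * N) = √((k : ℝ) ^ d) * √N := by
    rw [Real.sqrt_mul (by positivity), Real.sqrt_inv, ← mul_assoc, ← div_eq_mul_inv,
      Real.div_sqrt]
  rw [h2, ← h3]
  set b := binMean ((k : ℝ) ^ d)⁻¹ N (realMeanCost d p)
  set b' := binMean ((k : ℝ) ^ d)⁻¹ N fun n => |(n : ℝ) - ((k : ℝ) ^ d)⁻¹ * N|
  have h4 : (((k : ℝ) ^ d) ^ N)⁻¹ * ((k : ℝ)⁻¹ ^ p * ((k : ℝ) ^ d * (((k : ℝ) ^ d) ^ N * b)) +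
      (k : ℝ) ^ d * (((k : ℝ) ^ d) ^ N * b')) =
      (k : ℝ) ^ d * (k : ℝ)⁻¹ ^ p * b + (k : ℝ) ^ d * b' := by
    field_simp
  have h5 := mul_le_mul_of_nonneg_left h1 hkd.le
  linarith

end recursion

section lowerBound

variable {ι : Type} [Fintype ι] {d : ℕ} {p : ℝ}

lemma half_le_unifBox_compl_iUnion_ball {r : ℝ} (hr : 0 < r)
    (h : Fintype.card ι * (2 * r) ^ d ≤ 1 / 2) (x : ι → Fin d → ℝ) :
    ENNReal.ofReal (1 / 2) ≤ unifBox d (⋃ j, Metric.ball (x j) r)ᶜ := by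
  have h1 : unifBox d (⋃ j, Metric.ball (x j) r) ≤ ENNReal.ofReal (1 / 2) := by
    calc unifBox d (⋃ j, Metric.ball (x j) r)
        ≤ volume (⋃ j, Metric.ball (x j) r) := Measure.restrict_apply_le _ _
      _ ≤ ∑ j, volume (Metric.ball (x j) r) := measure_iUnion_fintype_le _ _
      _ = ENNReal.ofReal (Fintype.card ι * (2 * r) ^ d) := by
          simp only [Real.volume_pi_ball _ hr, Fintype.card_fin, Finset.sum_const,
            Finset.card_univ, nsmul_eq_mul]
          rw [ENNReal.ofReal_mul (by positivity), ENNReal.ofReal_natCast]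
      _ ≤ _ := ENNReal.ofReal_le_ofReal h
  rw [prob_compl_eq_one_sub (MeasurableSet.iUnion fun j => measurableSet_ball)]
  calc ENNReal.ofReal (1 / 2) = 1 - ENNReal.ofReal (1 / 2) := by
        rw [← ENNReal.ofReal_one, ← ENNReal.ofReal_sub _ (by norm_num)]
        norm_num
    _ ≤ _ := tsub_le_tsub_left h1 1

lemma le_matchCost (hp : 0 ≤ p) {r : ℝ} (hr : 0 < r)
    (h : Fintype.card ι * (2 * r) ^ d ≤ 1 / 2) (x : ι → Fin d → ℝ) :
    ENNReal.ofReal (r ^ p * (Fintype.card ι / 2)) ≤ matchCost p x := by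
  refine le_iInf₂ fun ν hν => ?_
  set A : Set (Fin d → ℝ) := (⋃ j, Metric.ball (x j) r)ᶜ with hA
  have hAm : MeasurableSet A := (MeasurableSet.iUnion fun j => measurableSet_ball).compl
  have h1 : ∀ j, ENNReal.ofReal (r ^ p) * ν j A ≤ ∫⁻ z, (‖z - x j‖₊ : ℝ≥0∞) ^ p ∂ν j := by
    intro j
    rw [← setLIntegral_const]
    refine (setLIntegral_mono_ae' hAm (Filter.Eventually.of_forall fun z hz => ?_)).trans
      (setLIntegral_le_lintegral A _)
    have hz' : r ≤ ‖z - x j‖ := by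
      simp only [hA, Set.mem_compl_iff, Set.mem_iUnion, Metric.mem_ball, not_exists, not_lt,
        dist_eq_norm] at hz
      exact hz j
    rw [← ENNReal.ofReal_rpow_of_nonneg hr.le hp]
    gcongr
    rw [← enorm_eq_nnnorm, ← ofReal_norm]
    exact ENNReal.ofReal_le_ofReal hz'
  calc ENNReal.ofReal (r ^ p * (Fintype.card ι / 2))
      = ENNReal.ofReal (r ^ p) * (Fintype.card ι * ENNReal.ofReal (1 / 2)) := by
        rw [ENNReal.ofReal_mul (by positivity), div_eq_mul_one_div,
          ENNReal.ofReal_mul (by positivity), ENNReal.ofReal_natCast]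
    _ ≤ ENNReal.ofReal (r ^ p) * (Fintype.card ι * unifBox d A) := by
        gcongr
        exact half_le_unifBox_compl_iUnion_ball hr h x
    _ = ∑ j, ENNReal.ofReal (r ^ p) * ν j A := by
        rw [← Finset.mul_sum, ← Measure.finsetSum_apply, hν.1, Measure.smul_apply, smul_eq_mul]
    _ ≤ splitCost p x ν := Finset.sum_le_sum fun j _ => h1 j

lemma le_realMeanCost (hp : 0 ≤ p) (hd : 0 < d) {N : ℕ} (hN : 1 ≤ N) :
    (2⁻¹ * 2 ^ (-(1 / d) : ℝ)) ^ p / 2 * (N : ℝ) ^ (1 - p / d) ≤ realMeanCost d p N := by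
  have hN0 : (0 : ℝ) < N := by exact_mod_cast hN
  have hd0 : (d : ℝ) ≠ 0 := by exact_mod_cast hd.ne'
  set r : ℝ := 2⁻¹ * (2 * N) ^ (-(1 / d) : ℝ) with hr
  have hr0 : 0 < r := by positivity
  have hball : (N : ℝ) * (2 * r) ^ d ≤ 1 / 2 := by
    rw [hr, mul_inv_cancel_left₀ two_ne_zero, ← Real.rpow_natCast, ← Real.rpow_mul (by positivity),
      neg_mul, one_div_mul_cancel hd0, Real.rpow_neg_one]
    field_simp
    rfl
  have hle : ENNReal.ofReal (r ^ p * (N / 2)) ≤ meanMatchCost (Fin N) d p := by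
    calc ENNReal.ofReal (r ^ p * (N / 2))
        = ∫⁻ _, ENNReal.ofReal (r ^ p * (N / 2)) ∂Measure.pi fun _ : Fin N => unifBox d := by simp
      _ ≤ _ := lintegral_mono fun x => by
          simpa using le_matchCost hp hr0 (by simpa using hball) x
  rw [meanMatchCost_eq_ofReal hp, Fintype.card_fin,
    ENNReal.ofReal_le_ofReal_iff (realMeanCost_nonneg N)] at hle
  refine le_of_eq_of_le ?_ hle
  rw [hr, Real.mul_rpow (x := 2) (y := N) (by positivity) (by positivity), ← mul_assoc,
    Real.mul_rpow (y := (N : ℝ) ^ _) (by positivity) (by positivity),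
    ← Real.rpow_mul hN0.le, sub_eq_add_neg, Real.rpow_add hN0, Real.rpow_one,
    show -(1 / (d : ℝ)) * p = -(p / d) by ring]
  ring

end lowerBound

section coupling

variable {d : ℕ} {p : ℝ}

lemma wpPow_le_matchCost {N : ℕ} (hN : 1 ≤ N) (x : Fin N → Fin d → ℝ) :
    WpPow p (unifBox d) (empMeas N x) ≤ (N : ℝ≥0∞)⁻¹ * matchCost p x := by
  have hN0 : (N : ℝ≥0∞) ≠ 0 := by simp; omega
  have hNt : (N : ℝ≥0∞)⁻¹ ≠ ⊤ := by simp; omega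
  obtain ⟨ν, hν, hνt⟩ := exists_seq_splitCost_tendsto p x
  refine ge_of_tendsto' (ENNReal.Tendsto.const_mul hνt (Or.inr hNt)) fun s => ?_
  have hm : ∀ j, Measurable fun z : Fin d → ℝ => (z, x j) := fun j => by fun_prop
  set ξ : Measure ((Fin d → ℝ) × (Fin d → ℝ)) :=
    (N : ℝ≥0∞)⁻¹ • ∑ j, (ν s j).map fun z => (z, x j) with hξ
  have hfst : ξ.map Prod.fst = unifBox d := by
    rw [hξ, Measure.map_smul, Measure.map_finset_sum' measurable_fst.aemeasurable]
    have : ∀ j, ((ν s j).map fun z => (z, x j)).map Prod.fst = ν s j := fun j => by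
      rw [Measure.map_map measurable_fst (hm j)]
      exact Measure.map_id
    rw [Finset.sum_congr rfl fun j _ => this j, (hν s).1, smul_smul, Fintype.card_fin,
      ENNReal.inv_mul_cancel hN0 (ENNReal.natCast_ne_top N), one_smul]
  have hsnd : ξ.map Prod.snd = empMeas N x := by
    rw [hξ, Measure.map_smul, Measure.map_finset_sum' measurable_snd.aemeasurable, empMeas]
    congr 1
    refine Finset.sum_congr rfl fun j _ => ?_
    rw [Measure.map_map measurable_snd (hm j)]
    have : (Prod.snd ∘ fun z : Fin d → ℝ => (z, x j)) = fun _ => x j := rfl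
    rw [this, Measure.map_const, (hν s).2 j, one_smul]
  refine (iInf₂_le ξ ⟨hfst, hsnd⟩).trans_eq ?_
  rw [hξ, lintegral_smul_measure, lintegral_finsetSum_measure, smul_eq_mul, splitCost]
  congr 1
  refine Finset.sum_congr rfl fun j _ => ?_
  rw [lintegral_map (by fun_prop) (hm j)]

lemma matchCost_le_wpPow {N : ℕ} (hN : 1 ≤ N) (x : Fin N → Fin d → ℝ) :
    (N : ℝ≥0∞)⁻¹ * matchCost p x ≤ WpPow p (unifBox d) (empMeas N x) := by
  have hN0 : (N : ℝ≥0∞) ≠ 0 := by simp; omega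
  have hNt : (N : ℝ≥0∞) ≠ ⊤ := ENNReal.natCast_ne_top N
  refine le_iInf₂ fun ξ hξ => ?_
  obtain ⟨hfst, hsnd⟩ := hξ
  set m : Fin N → ℝ≥0∞ := fun j => (∑ k, Measure.dirac (x k)) {x j} with hm
  have hm' : ∀ j, m j = ∑ k, Set.indicator {x j} 1 (x k) := fun j => by
    simp only [hm, Measure.finsetSum_apply]
    exact Finset.sum_congr rfl fun k _ => Measure.dirac_apply' _ (measurableSet_singleton _)
  have hm0 : ∀ j, m j ≠ 0 := fun j h => by
    rw [hm', Finset.sum_eq_zero_iff] at h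
    simpa using h j (Finset.mem_univ j)
  have hmt : ∀ j, m j ≠ ⊤ := fun j => measure_ne_top _ _
  have hS : ∀ j, MeasurableSet (Prod.snd ⁻¹' {x j} : Set ((Fin d → ℝ) × (Fin d → ℝ))) :=
    fun j => measurable_snd (measurableSet_singleton _)
  have hrange : ∀ᵐ z ∂ξ, z.2 ∈ Set.range x := by
    have hfin : MeasurableSet (Set.range x)ᶜ := (Set.finite_range x).measurableSet.compl
    have h0 : ξ.map Prod.snd (Set.range x)ᶜ = 0 := by
      rw [hsnd, empMeas, Measure.smul_apply, Measure.finsetSum_apply]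
      refine mul_eq_zero_of_right _ (Finset.sum_eq_zero fun j _ => ?_)
      rw [Measure.dirac_apply' _ hfin]
      simp
    rw [Measure.map_apply measurable_snd hfin] at h0
    exact h0
  have key : ∀ F : (Fin d → ℝ) × (Fin d → ℝ) → ℝ≥0∞, Measurable F →
      ∑ j, (m j)⁻¹ * ∫⁻ z in Prod.snd ⁻¹' {x j}, F z ∂ξ = ∫⁻ z, F z ∂ξ := by
    intro F hF
    have e1 : ∀ j, (m j)⁻¹ * ∫⁻ z in Prod.snd ⁻¹' {x j}, F z ∂ξ =
        ∫⁻ z, (m j)⁻¹ * (Prod.snd ⁻¹' {x j}).indicator F z ∂ξ := fun j => by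
      rw [lintegral_const_mul _ (hF.indicator (hS j)), lintegral_indicator (hS j)]
    rw [Finset.sum_congr rfl fun j _ => e1 j,
      ← lintegral_finsetSum _ fun j _ => (hF.indicator (hS j)).const_mul _]
    apply lintegral_congr_ae
    filter_upwards [hrange] with z hz
    obtain ⟨k, hk⟩ := hz
    have e2 : ∀ j, (m j)⁻¹ * (Prod.snd ⁻¹' {x j}).indicator F z =
        (m k)⁻¹ * F z * Set.indicator {x k} 1 (x j) := fun j => by
      by_cases h : x j = x k
      · have : m j = m k := by simp only [hm, h]
        rw [Set.indicator_of_mem (by simp [← hk, h]), this, Set.indicator_of_mem (by simp [h])]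
        simp
      · rw [Set.indicator_of_notMem (by simp [← hk, Ne.symm h]),
          Set.indicator_of_notMem (by simp [h]), mul_zero, mul_zero]
    rw [Finset.sum_congr rfl fun j _ => e2 j, ← Finset.mul_sum, ← hm', mul_right_comm,
      ENNReal.inv_mul_cancel (hm0 k) (hmt k), one_mul]
  set ν : Fin N → Measure (Fin d → ℝ) := fun j =>
    (N * (m j)⁻¹) • (ξ.restrict (Prod.snd ⁻¹' {x j})).map Prod.fst with hν
  have hmem : ν ∈ splittings (Fin N) d := by
    refine ⟨?_, fun j => ?_⟩
    · ext s hs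
      rw [Measure.finsetSum_apply, Measure.smul_apply, ← hfst, Measure.map_apply measurable_fst hs,
        Fintype.card_fin, smul_eq_mul, ← lintegral_indicator_one (measurable_fst hs),
        ← key _ (measurable_one.indicator (measurable_fst hs)), Finset.mul_sum]
      refine Finset.sum_congr rfl fun j _ => ?_
      rw [lintegral_indicator_one (measurable_fst hs), Measure.smul_apply,
        Measure.map_apply measurable_fst hs, smul_eq_mul, mul_assoc]
    · have e : ξ (Prod.snd ⁻¹' {x j}) = (N : ℝ≥0∞)⁻¹ * m j := by
        rw [← Measure.map_apply measurable_snd (measurableSet_singleton _), hsnd]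
        rfl
      simp only [hν]
      rw [Measure.smul_apply, Measure.map_apply measurable_fst MeasurableSet.univ,
        Set.preimage_univ, Measure.restrict_apply_univ, e, smul_eq_mul, mul_mul_mul_comm,
        ENNReal.mul_inv_cancel hN0 hNt, ENNReal.inv_mul_cancel (hm0 j) (hmt j), one_mul]
  have hcost : splitCost p x ν = N * ∫⁻ z, (‖z.1 - z.2‖₊ : ℝ≥0∞) ^ p ∂ξ := by
    rw [← key _ (by fun_prop), Finset.mul_sum, splitCost]
    refine Finset.sum_congr rfl fun j _ => ?_
    simp only [hν]
    rw [lintegral_smul_measure, lintegral_map (measurable_rpow_nnnorm_sub p _) measurable_fst,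
      smul_eq_mul, mul_assoc]
    congr 2
    refine setLIntegral_congr_fun (hS j) fun z hz => ?_
    have hz' : z.2 = x j := hz
    simp only [hz']
  calc (N : ℝ≥0∞)⁻¹ * matchCost p x ≤ (N : ℝ≥0∞)⁻¹ * splitCost p x ν :=
        mul_le_mul_right (matchCost_le hmem) _
    _ = _ := by rw [hcost, ← mul_assoc, ENNReal.inv_mul_cancel hN0 hNt, one_mul]

lemma expWpPow_unifBox (hp : 0 ≤ p) {N : ℕ} (hN : 1 ≤ N) :
    expWpPow p (unifBox d) N = (N : ℝ≥0∞)⁻¹ * ENNReal.ofReal (realMeanCost d p N) := by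
  have h : ∀ x : Fin N → Fin d → ℝ,
      WpPow p (unifBox d) (empMeas N x) = (N : ℝ≥0∞)⁻¹ * matchCost p x := fun x =>
    (wpPow_le_matchCost hN x).antisymm (matchCost_le_wpPow hN x)
  rw [expWpPow, lintegral_congr h, lintegral_const_mul _ (measurable_matchCost hp)]
  congr 1
  exact (meanMatchCost_eq_ofReal hp).trans (by rw [Fintype.card_fin])

end coupling

/-- Existence of the high-resolution constant for the uniform distribution:
for `d ≥ 3` and `1 ≤ p < d/2`, the limit
`lim_N N^{1/d} E[ρ_p^p(U, Û_N)]^{1/p}` exists in `(0, ∞)`, where `U` is the uniform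
distribution on `[0,1)^d`. -/
theorem uniform_high_resolution_limit {d : ℕ} (hd : 3 ≤ d) (p : ℝ)
    (hp : 1 ≤ p) (hpd : 2 * p < d) :
    ∃ κ : ℝ≥0∞, 0 < κ ∧ κ < ⊤ ∧
      Filter.Tendsto (fun N : ℕ => (N : ℝ≥0∞) ^ ((d : ℝ)⁻¹) *
          (expWpPow p (volume.restrict (unitBox d)) N) ^ (1 / p))
        Filter.atTop (nhds κ) := by
  have hd0 : 0 < d := by omega
  have hp0 : 0 < p := by linarith
  obtain ⟨κ, hκ⟩ := tendsto_div_rpow_of_binBound hd0 hp0 hpd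
    (realMeanCost_nonneg (d := d) (p := p)) (realMeanCost_le hp0.le) (realMeanCost_add_le hp0.le)
    fun k hk => binBound_realMeanCost hp0.le hk
  set c : ℝ := (2⁻¹ * 2 ^ (-(1 / d) : ℝ)) ^ p / 2 with hc
  have hc0 : 0 < c := by positivity
  have hcκ : c ≤ κ := by
    refine ge_of_tendsto hκ ?_
    filter_upwards [Filter.eventually_ge_atTop 1] with N hN
    have hN0 : (0 : ℝ) < N := by exact_mod_cast hN
    rw [le_div_iff₀ (by positivity)]
    exact le_realMeanCost hp0.le hd0 hN
  have hκ0 : 0 < κ := hc0.trans_le hcκ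
  refine ⟨ENNReal.ofReal (κ ^ (1 / p)), ENNReal.ofReal_pos.2 (by positivity),
    ENNReal.ofReal_lt_top, ?_⟩
  refine (ENNReal.tendsto_ofReal (hκ.rpow_const (p := 1 / p) (Or.inl hκ0.ne'))).congr' ?_
  filter_upwards [Filter.eventually_ge_atTop 1] with N hN
  have hN0 : (0 : ℝ) < N := by exact_mod_cast hN
  have hg := realMeanCost_nonneg (d := d) (p := p) N
  change _ = _ * expWpPow p (unifBox d) N ^ _
  rw [expWpPow_unifBox hp0.le hN, ← ENNReal.ofReal_natCast, ← ENNReal.ofReal_inv_of_pos hN0,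
    ← ENNReal.ofReal_mul (by positivity), ENNReal.ofReal_rpow_of_pos hN0,
    ENNReal.ofReal_rpow_of_nonneg (by positivity) (by positivity),
    ← ENNReal.ofReal_mul (by positivity)]
  congr 1
  have e1 : realMeanCost d p N / (N : ℝ) ^ (1 - p / d) =
      ((N : ℝ) ^ (d : ℝ)⁻¹) ^ p * ((N : ℝ)⁻¹ * realMeanCost d p N) := by
    rw [Real.rpow_sub hN0, Real.rpow_one, ← Real.rpow_mul hN0.le,
      show (d : ℝ)⁻¹ * p = p / d by ring]
    field_simp
  rw [e1, Real.mul_rpow (by positivity) (by positivity), one_div,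
    Real.rpow_rpow_inv (by positivity) hp0.ne']
end
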